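/- Let r be a nonnegative integer, U a definable open subset of ℝⁿ, f: U → ℝ a definable function of class C^r, and δ: U → ℝ a positive definable continuous function. Then there exists a definable function f̃: U → ℝ of class C^{r+1} such that |f(x) − f̃(x)| < δ(x) for all x ∈ U. -/

import Mathlib

open FirstOrder Set Topology

namespace Paper

variable (L : FirstOrder.Language) [L.Structure ℝ]

/-- A subset of `ℝⁿ` is definable in the structure (with parameters from `ℝ`). -/
def Def (n : ℕ) (s : Set (Fin n → ℝ)) : Prop :=
  Set.Definable (Set.univ : Set ℝ) L s

/-- A subset of `ℝ` is definable. -/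
def Def1 (s : Set ℝ) : Prop := Def L 1 {x | x 0 ∈ s}

/-- The structure expands the ordered field `(ℝ, <, +, ·, 0, 1)`:
the order and the field operations (and the constants) are definable. -/
def ExpandsOrderedField : Prop :=
  Def L 2 {x | x 0 < x 1} ∧ Def L 3 {x | x 0 + x 1 = x 2} ∧
  Def L 3 {x | x 0 * x 1 = x 2} ∧ Def L 1 {x | x 0 = 0} ∧ Def L 1 {x | x 0 = 1}

/-- Local o-minimality: every definable subset of `ℝ` is, near each point, a finite
union of points and open intervals. -/
def LocallyOMinimal : Prop :=
  ∀ X : Set ℝ, Def1 L X → ∀ a : ℝ,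
    ∃ b c : ℝ, b < a ∧ a < c ∧
      ∃ (P : Finset ℝ) (J : Finset (ℝ × ℝ)),
        X ∩ Set.Ioo b c = ↑P ∪ ⋃ p ∈ J, Set.Ioo p.1 p.2

/-- First component of a point of `ℝ^(m+n) = ℝ^m × ℝ^n`. -/
def fstFun {m n : ℕ} (z : Fin (m + n) → ℝ) : Fin m → ℝ := fun i => z (Fin.castAdd n i)

/-- Second component of a point of `ℝ^(m+n) = ℝ^m × ℝ^n`. -/
def sndFun {m n : ℕ} (z : Fin (m + n) → ℝ) : Fin n → ℝ := fun j => z (Fin.natAdd m j)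

/-- The map `f : X → ℝⁿ`, `X ⊆ ℝ^m`, is definable (its graph over `X` is definable). -/
def DefMapOn (m n : ℕ) (X : Set (Fin m → ℝ)) (f : (Fin m → ℝ) → (Fin n → ℝ)) : Prop :=
  Def L (m + n) {z | fstFun z ∈ X ∧ sndFun z = f (fstFun z)}

/-- The function `f : X → ℝ`, `X ⊆ ℝ^m`, is definable. -/
def DefFunOn (m : ℕ) (X : Set (Fin m → ℝ)) (f : (Fin m → ℝ) → ℝ) : Prop :=
  DefMapOn L m 1 X fun x _ => f x

/-- `f` is of class `C^r` on `X` in the sense that near every point of `X` it agrees on `X`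
with a `C^r` map defined on an open neighborhood in the ambient space. -/
def CrMapOn (r m n : ℕ) (X : Set (Fin m → ℝ)) (f : (Fin m → ℝ) → (Fin n → ℝ)) : Prop :=
  ∀ a ∈ X, ∃ (W : Set (Fin m → ℝ)) (g : (Fin m → ℝ) → (Fin n → ℝ)),
    a ∈ W ∧ IsOpen W ∧ ContDiffOn ℝ r g W ∧ Set.EqOn f g (X ∩ W)

/-- Real-valued version of `CrMapOn`. -/
def CrFunOn (r m : ℕ) (X : Set (Fin m → ℝ)) (f : (Fin m → ℝ) → ℝ) : Prop :=
  ∀ a ∈ X, ∃ (W : Set (Fin m → ℝ)) (g : (Fin m → ℝ) → ℝ),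
    a ∈ W ∧ IsOpen W ∧ ContDiffOn ℝ r g W ∧ Set.EqOn f g (X ∩ W)

/-- A definable `C^r` map `X → ℝⁿ`. -/
def DefCrMapOn (r m n : ℕ) (X : Set (Fin m → ℝ)) (f : (Fin m → ℝ) → (Fin n → ℝ)) : Prop :=
  DefMapOn L m n X f ∧ CrMapOn r m n X f

/-- A definable `C^r` function `X → ℝ`. -/
def DefCrFunOn (r m : ℕ) (X : Set (Fin m → ℝ)) (f : (Fin m → ℝ) → ℝ) : Prop :=
  DefFunOn L m X f ∧ CrFunOn r m X f

/-- A definable `C^r` submanifold of `ℝⁿ` of dimension `d`: around every point there is a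
definable `C^r` chart of `ℝⁿ` straightening `M` to the first `d` coordinates. -/
def IsDefCrSubmanifold (r n d : ℕ) (M : Set (Fin n → ℝ)) : Prop :=
  Def L n M ∧
  ∀ a ∈ M, ∃ (U V : Set (Fin n → ℝ)) (φ ψ : (Fin n → ℝ) → (Fin n → ℝ)),
    a ∈ U ∧ IsOpen U ∧ Def L n U ∧
    (0 : Fin n → ℝ) ∈ V ∧ IsOpen V ∧ Def L n V ∧
    DefMapOn L n n U φ ∧ DefMapOn L n n V ψ ∧
    ContDiffOn ℝ r φ U ∧ ContDiffOn ℝ r ψ V ∧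
    Set.BijOn φ U V ∧ Set.InvOn ψ φ U V ∧
    φ a = 0 ∧
    φ '' (M ∩ U) = {x ∈ V | ∀ i : Fin n, d ≤ (i : ℕ) → x i = 0}

/-- The Euclidean norm on `ℝⁿ`. -/
noncomputable def eunorm {n : ℕ} (x : Fin n → ℝ) : ℝ := Real.sqrt (∑ i, x i ^ 2)

/-- Projection of `ℝⁿ` onto the `d` coordinates selected by `σ`. -/
def coordProj {n : ℕ} (d : ℕ) (σ : Fin d → Fin n) (x : Fin n → ℝ) : Fin d → ℝ :=
  fun i => x (σ i)

/-- `X ⊆ ℝⁿ` has dimension `d`: `d` is the largest integer such that some coordinate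
projection of `X` onto `ℝ^d` has nonempty interior. -/
def HasDim {n : ℕ} (X : Set (Fin n → ℝ)) (d : ℕ) : Prop :=
  (∃ σ : Fin d → Fin n, Function.Injective σ ∧ (interior (coordProj d σ '' X)).Nonempty) ∧
  ∀ (e : ℕ) (σ : Fin e → Fin n), Function.Injective σ →
    (interior (coordProj e σ '' X)).Nonempty → e ≤ d

/-- A (bounded) open box in `ℝⁿ`. -/
def IsOpenBox {n : ℕ} (B : Set (Fin n → ℝ)) : Prop :=
  ∃ a b : Fin n → ℝ, (∀ i, a i < b i) ∧ B = Set.pi Set.univ fun i => Set.Ioo (a i) (b i)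

set_option synthInstance.maxHeartbeats 200000
set_option synthInstance.maxSize 100000

section Calculus

/-- A metric space identified isometrically with some `ℝ^ι` (sup metric), `ι` finite. -/
class DefSpace (E : Type) [PseudoMetricSpace E] where
  /-- the coordinates -/
  idx : Type
  [fintypeIdx : Fintype idx]
  /-- the coordinate isometry -/
  chart : E ≃ᵢ (idx → ℝ)

attribute [reducible, instance] DefSpace.fintypeIdx

open DefSpace

instance : DefSpace ℝ where
  idx := Unit
  chart := (IsometryEquiv.funUnique Unit ℝ).symm

instance {ι : Type} [Fintype ι] : DefSpace (ι → ℝ) where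
  idx := ι
  chart := IsometryEquiv.refl _

/-- The coordinate isometry of a product. -/
def prodChart (E F : Type) [PseudoMetricSpace E] [PseudoMetricSpace F] [DefSpace E]
    [DefSpace F] : E × F ≃ᵢ (idx E ⊕ idx F → ℝ) :=
  IsometryEquiv.trans
    { toEquiv := (chart (E := E)).toEquiv.prodCongr (chart (E := F)).toEquiv
      isometry_toFun := (chart (E := E)).isometry.prodMap (chart (E := F)).isometry }
    IsometryEquiv.sumArrowIsometryEquivProdArrow.symm

instance {E F : Type} [PseudoMetricSpace E] [PseudoMetricSpace F] [DefSpace E] [DefSpace F] :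
    DefSpace (E × F) where
  idx := idx E ⊕ idx F
  chart := prodChart E F

variable {E F G : Type} [PseudoMetricSpace E] [PseudoMetricSpace F] [PseudoMetricSpace G]
  [DefSpace E] [DefSpace F] [DefSpace G]

/-- A predicate on a coordinatized space is definable. -/
class DefPred (p : E → Prop) : Prop where
  out : (univ : Set ℝ).Definable L {v : idx E → ℝ | p (chart.symm v)}

/-- A map of coordinatized spaces is definable: its graph is. -/
class DefMap (f : E → F) : Prop where
  out : DefPred L fun z : E × F => z.2 = f z.1

/-- A map which permutes, repeats or forgets coordinates. -/
def IsReindex (φ : E → F) : Prop :=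
  ∃ τ : idx F → idx E, ∀ x j, chart (φ x) j = chart x (τ j)

variable {L}

theorem DefPred.reindex {q : F → Prop} (hq : DefPred L q) {φ : E → F} (hφ : IsReindex φ) :
    DefPred L fun x => q (φ x) := by
  obtain ⟨τ, h⟩ := hφ
  refine ⟨?_⟩
  have := hq.out.preimage_comp τ
  convert this using 1
  ext v
  simp only [mem_ofPred_eq, mem_preimage]
  have : φ (chart.symm v) = chart.symm (v ∘ τ) := by
    rw [IsometryEquiv.eq_symm_apply]
    ext j
    simp [h]
  rw [this]

theorem isReindex_fst : IsReindex (Prod.fst : E × F → E) := ⟨Sum.inl, fun _ _ => rfl⟩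

theorem isReindex_snd : IsReindex (Prod.snd : E × F → F) := ⟨Sum.inr, fun _ _ => rfl⟩

theorem isReindex_id : IsReindex (fun x : E => x) := ⟨fun j => j, fun _ _ => rfl⟩

theorem IsReindex.pair {φ : E → F} {ψ : E → G} (hφ : IsReindex φ) (hψ : IsReindex ψ) :
    IsReindex fun x => (φ x, ψ x) := by
  obtain ⟨τ, h⟩ := hφ
  obtain ⟨σ, h'⟩ := hψ
  refine ⟨Sum.elim τ σ, fun x j => ?_⟩
  rcases j with j | j
  · exact h x j
  · exact h' x j

theorem IsReindex.comp {φ : E → F} {ψ : F → G} (hψ : IsReindex ψ) (hφ : IsReindex φ) :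
    IsReindex fun x => ψ (φ x) := by
  obtain ⟨τ, h⟩ := hφ
  obtain ⟨σ, h'⟩ := hψ
  exact ⟨fun j => τ (σ j), fun x j => by rw [h', h]⟩

theorem isReindex_proj {ι κ : Type} [Fintype ι] [Fintype κ] (g : κ → ι) :
    IsReindex (fun (x : ι → ℝ) (j : κ) => x (g j)) := ⟨g, fun _ _ => rfl⟩

theorem isReindex_apply {ι : Type} [Fintype ι] (i : ι) :
    IsReindex (fun x : ι → ℝ => x i) := ⟨fun _ => i, fun _ _ => rfl⟩

theorem isReindex_chart : IsReindex (fun x : E => chart x) := ⟨fun j => j, fun _ _ => rfl⟩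

theorem isReindex_chart_symm : IsReindex (fun v : idx E → ℝ => (chart.symm v : E)) :=
  ⟨fun j => j, fun v j => by simp; rfl⟩

section Logic

protected instance DefPred.and {p q : E → Prop} [hp : DefPred L p] [hq : DefPred L q] :
    DefPred L fun x => p x ∧ q x := ⟨hp.out.inter hq.out⟩

protected instance DefPred.or {p q : E → Prop} [hp : DefPred L p] [hq : DefPred L q] :
    DefPred L fun x => p x ∨ q x := ⟨hp.out.union hq.out⟩

protected instance DefPred.not {p : E → Prop} [hp : DefPred L p] :
    DefPred L fun x => ¬ p x := ⟨hp.out.compl⟩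

protected instance DefPred.imp {p q : E → Prop} [DefPred L p] [DefPred L q] :
    DefPred L fun x => p x → q x := by
  simp only [imp_iff_not_or]
  infer_instance

protected instance DefPred.const (p : Prop) : DefPred L fun _ : E => p := by
  by_cases h : p
  · simp only [h]
    exact ⟨definable_univ⟩
  · simp only [h]
    exact ⟨definable_empty⟩

protected instance DefPred.exists {P : E → F → Prop} [h : DefPred L fun z : E × F => P z.1 z.2] :
    DefPred L fun x => ∃ y, P x y := by
  refine ⟨?_⟩
  have := Definable.exists_of_finite (A := univ) (α := idx E) (β := idx F) h.out
  convert this using 1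
  ext v
  constructor
  · rintro ⟨y, hy⟩
    refine ⟨chart y, ?_⟩
    have e : (chart.symm (Sum.elim v (chart y) : idx (E × F) → ℝ) : E × F)
        = (chart.symm v, y) := by
      rw [IsometryEquiv.symm_apply_eq]
      ext j
      rcases j with j | j
      · exact (congrFun (IsometryEquiv.apply_symm_apply chart v) j).symm
      · rfl
    change P (chart.symm (Sum.elim v (chart y) : idx (E × F) → ℝ) : E × F).1
      (chart.symm (Sum.elim v (chart y) : idx (E × F) → ℝ) : E × F).2
    rw [e]
    exact hy
  · rintro ⟨u, hu⟩
    refine ⟨chart.symm u, ?_⟩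
    exact hu

protected instance DefPred.forall {P : E → F → Prop} [DefPred L fun z : E × F => P z.1 z.2] :
    DefPred L fun x => ∀ y, P x y := by
  have : DefPred L fun x => ¬ ∃ y, ¬ P x y := inferInstance
  simpa only [not_exists, not_not] using this

instance DefPred.forall_finite {ι : Type} [Finite ι] {P : E → ι → Prop}
    [h : ∀ i, DefPred L fun x => P x i] : DefPred L fun x => ∀ i, P x i := by
  refine ⟨?_⟩
  have := definable_iInter_of_finite (fun i => (h i).out)
  convert this using 1
  ext v
  simp

theorem DefPred.comp_map {q : F → Prop} {f : E → F} (hq : DefPred L q) (hf : DefMap L f) :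
    DefPred L fun x => q (f x) := by
  have h1 := hf.out
  have h2 := hq.reindex (isReindex_snd (E := E))
  have : DefPred L fun x => ∃ y, y = f x ∧ q y := DefPred.exists
  simpa using this

protected instance (priority := low) DefPred.comp {q : F → Prop} {f : E → F} [hq : DefPred L q]
    [hf : DefMap L f] : DefPred L fun x => q (f x) := hq.comp_map hf

protected instance DefPred.mem {s : Set F} {f : E → F} [hq : DefPred L fun y => y ∈ s]
    [hf : DefMap L f] : DefPred L fun x => f x ∈ s := hq.comp_map hf

theorem DefPred.coord_eq (i j : idx E) : DefPred L fun x : E => chart x i = chart x j := by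
  refine ⟨?_⟩
  have := (Definable.diagonal (M := ℝ) L univ).preimage_comp ![i, j]
  convert this using 1
  ext v
  simp

theorem DefPred.coord_eq_const (i : idx E) (c : ℝ) : DefPred L fun x : E => chart x i = c := by
  refine ⟨?_⟩
  have := (Definable.singleton_of_mem L (mem_univ c)).preimage_comp (fun _ => i)
  convert this using 1
  ext v
  simp

theorem IsReindex.defMap {φ : E → F} (hφ : IsReindex φ) : DefMap L φ := by
  obtain ⟨τ, h⟩ := hφ
  refine ⟨?_⟩
  have (j : idx F) : DefPred L fun z : E × F => chart z.2 j = chart z.1 (τ j) :=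
    DefPred.coord_eq (E := E × F) (Sum.inr j) (Sum.inl (τ j))
  have : DefPred L fun z : E × F => ∀ j, chart z.2 j = chart z.1 (τ j) := inferInstance
  convert this using 2 with z
  rw [← (chart (E := F)).injective.eq_iff, funext_iff]
  simp only [h]

protected instance DefMap.const (c : F) : DefMap L fun _ : E => c := by
  refine ⟨?_⟩
  have (j : idx F) : DefPred L fun z : E × F => chart z.2 j = chart c j :=
    DefPred.coord_eq_const (E := E × F) (Sum.inr j) _
  have : DefPred L fun z : E × F => ∀ j, chart z.2 j = chart c j := inferInstance
  convert this using 2 with z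
  rw [← (chart (E := F)).injective.eq_iff, funext_iff]

protected instance DefMap.id : DefMap L fun x : E => x := isReindex_id.defMap

theorem DefMap.comp_map {g : F → G} {f : E → F} (hg : DefMap L g) (hf : DefMap L f) :
    DefMap L fun x => g (f x) := by
  refine ⟨?_⟩
  have h1 : DefPred L fun z : (E × G) × F => z.2 = f z.1.1 :=
    hf.out.reindex (φ := fun z : (E × G) × F => (z.1.1, z.2))
      ((isReindex_fst.comp isReindex_fst).pair isReindex_snd)
  have h2 : DefPred L fun z : (E × G) × F => z.1.2 = g z.2 :=
    hg.out.reindex (φ := fun z : (E × G) × F => (z.2, z.1.2))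
      (isReindex_snd.pair (isReindex_snd.comp isReindex_fst))
  have : DefPred L fun z : E × G => ∃ y, y = f z.1 ∧ z.2 = g y := DefPred.exists
  simpa using this

protected instance (priority := low) DefMap.comp {g : F → G} {f : E → F} [hg : DefMap L g]
    [hf : DefMap L f] : DefMap L fun x => g (f x) := hg.comp_map hf

protected instance DefMap.fst {f : E → F × G} [hf : DefMap L f] : DefMap L fun x => (f x).1 :=
  isReindex_fst.defMap.comp_map hf

protected instance DefMap.snd {f : E → F × G} [hf : DefMap L f] : DefMap L fun x => (f x).2 :=
  isReindex_snd.defMap.comp_map hf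

instance DefMap.pair {f : E → F} {g : E → G} [hf : DefMap L f] [hg : DefMap L g] :
    DefMap L fun x => (f x, g x) := by
  refine ⟨?_⟩
  have h1 : DefPred L fun z : E × (F × G) => z.2.1 = f z.1 :=
    hf.out.reindex (φ := fun z : E × (F × G) => (z.1, z.2.1))
      (isReindex_fst.pair (isReindex_fst.comp isReindex_snd))
  have h2 : DefPred L fun z : E × (F × G) => z.2.2 = g z.1 :=
    hg.out.reindex (φ := fun z : E × (F × G) => (z.1, z.2.2))
      (isReindex_fst.pair (isReindex_snd.comp isReindex_snd))
  simp only [Prod.ext_iff]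
  infer_instance

instance DefMap.prodMk (c : F) : DefMap L (Prod.mk c : G → F × G) :=
  DefMap.pair (f := fun _ : G => c) (g := fun x : G => x)

instance (priority := low) DefPred.comp₂ {P : F → G → Prop} {f : E → F} {g : E → G}
    [hP : DefPred L fun z : F × G => P z.1 z.2] [hf : DefMap L f] [hg : DefMap L g] :
    DefPred L fun x => P (f x) (g x) := by
  have : DefMap L fun x => (f x, g x) := DefMap.pair
  exact hP.comp_map this

protected instance DefMap.apply {ι : Type} [Fintype ι] {f : E → ι → ℝ} (i : ι) [hf : DefMap L f] :
    DefMap L fun x => f x i :=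
  (isReindex_apply i).defMap.comp_map hf

protected theorem DefMap.pi {ι : Type} [Fintype ι] {f : E → ι → ℝ}
    (hf : ∀ i, DefMap L fun x => f x i) :
    DefMap L fun x i => f x i := by
  refine ⟨?_⟩
  have (i : ι) : DefPred L fun z : E × (ι → ℝ) => z.2 i = f z.1 i :=
    (hf i).out.reindex (φ := fun z : E × (ι → ℝ) => (z.1, z.2 i))
      (isReindex_fst.pair ((isReindex_apply i).comp isReindex_snd))
  simp only [funext_iff]
  infer_instance

protected instance DefMap.chart {f : E → F} [hf : DefMap L f] : DefMap L fun x => chart (f x) :=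
  isReindex_chart.defMap.comp_map hf

protected instance DefPred.eq {f g : E → F} [hf : DefMap L f] [hg : DefMap L g] :
    DefPred L fun x => f x = g x := by
  have h := hf.out.comp_map (f := fun x => (x, g x)) inferInstance
  simpa only [eq_comm] using h

protected instance DefMap.ite {c : E → Prop} [∀ x, Decidable (c x)] {f g : E → F} [hc : DefPred L c]
    [hf : DefMap L f] [hg : DefMap L g] : DefMap L fun x => if c x then f x else g x := by
  refine ⟨?_⟩
  have : DefPred L fun z : E × F => (c z.1 ∧ z.2 = f z.1) ∨ (¬ c z.1 ∧ z.2 = g z.1) :=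
    inferInstance
  convert this using 2 with z
  by_cases h : c z.1 <;> simp [h]

/-- A function given by a definable functional relation is definable. -/
theorem DefMap.of_graph {f : E → F} (R : E → F → Prop) [h : DefPred L fun z : E × F => R z.1 z.2]
    (hR : ∀ x y, y = f x ↔ R x y) : DefMap L f := by
  refine ⟨?_⟩
  simpa only [hR] using h

end Logic

end Calculus

section Arithmetic

variable {E F : Type} [PseudoMetricSpace E] [PseudoMetricSpace F] [DefSpace E] [DefSpace F]

/-- A locally o-minimal structure on `ℝ` expanding the ordered field. -/
class TameField : Prop where
  field : ExpandsOrderedField L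
  locallyOMinimal : LocallyOMinimal L

variable {L} [hT : TameField L]

protected instance DefPred.lt {f g : E → ℝ} [DefMap L f] [DefMap L g] :
    DefPred L fun x => f x < g x := by
  have h : DefPred L fun x : Fin 2 → ℝ => x 0 < x 1 := ⟨hT.field.1⟩
  have hfg : DefMap L fun x => ![f x, g x] := by
    have : ∀ i, DefMap L fun x => ![f x, g x] i := fun i => by
      fin_cases i <;> simpa
    exact DefMap.pi this
  exact h.comp_map hfg

protected instance DefPred.le {f g : E → ℝ} [DefMap L f] [DefMap L g] :
    DefPred L fun x => f x ≤ g x := by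
  simp only [← not_lt]
  infer_instance

omit hT in
theorem DefPred.fin_three {P : ℝ → ℝ → ℝ → Prop}
    (h : Def L 3 {x | P (x 0) (x 1) (x 2)}) {f g k : E → ℝ}
    (hf : DefMap L f) (hg : DefMap L g) (hk : DefMap L k) :
    DefPred L fun x => P (f x) (g x) (k x) := by
  have h : DefPred L fun x : Fin 3 → ℝ => P (x 0) (x 1) (x 2) := ⟨h⟩
  have hfg : DefMap L fun x => ![f x, g x, k x] := by
    have : ∀ i, DefMap L fun x => ![f x, g x, k x] i := fun i => by
      fin_cases i <;> simpa
    exact DefMap.pi this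
  exact h.comp_map hfg

protected instance DefMap.add {f g : E → ℝ} [DefMap L f] [DefMap L g] :
    DefMap L fun x => f x + g x := by
  refine DefMap.of_graph (h := ?_) _ fun _ _ => eq_comm
  exact DefPred.fin_three (P := fun a b c => a + b = c) hT.field.2.1 inferInstance inferInstance
    inferInstance

protected instance DefMap.mul {f g : E → ℝ} [DefMap L f] [DefMap L g] :
    DefMap L fun x => f x * g x := by
  refine DefMap.of_graph (h := ?_) _ fun _ _ => eq_comm
  exact DefPred.fin_three (P := fun a b c => a * b = c) hT.field.2.2.1 inferInstance inferInstance
    inferInstance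

protected instance DefMap.neg {f : E → ℝ} [DefMap L f] : DefMap L fun x => - f x := by
  have : DefMap L fun x => (-1) * f x := inferInstance
  simpa using this

protected instance DefMap.sub {f g : E → ℝ} [DefMap L f] [DefMap L g] :
    DefMap L fun x => f x - g x := by
  simp only [sub_eq_add_neg]
  infer_instance

protected instance DefMap.inv {f : E → ℝ} [DefMap L f] : DefMap L fun x => (f x)⁻¹ := by
  refine DefMap.of_graph (fun x y => (f x = 0 ∧ y = 0) ∨ f x * y = 1) fun x y => ?_
  by_cases h : f x = 0
  · simp [h]
  · simp only [h, false_and, false_or]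
    exact ⟨fun e => by rw [e, mul_inv_cancel₀ h], eq_inv_of_mul_eq_one_right⟩

protected instance DefMap.div {f g : E → ℝ} [DefMap L f] [DefMap L g] :
    DefMap L fun x => f x / g x := by
  simp only [div_eq_mul_inv]
  infer_instance

protected instance DefMap.max {f g : E → ℝ} [DefMap L f] [DefMap L g] :
    DefMap L fun x => max (f x) (g x) := by
  simp only [max_def]
  infer_instance

protected instance DefMap.min {f g : E → ℝ} [DefMap L f] [DefMap L g] :
    DefMap L fun x => min (f x) (g x) := by
  simp only [min_def]
  infer_instance

protected instance DefMap.abs {f : E → ℝ} [DefMap L f] : DefMap L fun x => |f x| := by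
  simp only [abs_eq_max_neg]
  infer_instance

protected instance DefMap.pow {f : E → ℝ} [DefMap L f] (n : ℕ) : DefMap L fun x => f x ^ n := by
  induction n with
  | zero => simp only [pow_zero]; infer_instance
  | succ n ih => simp only [pow_succ]; infer_instance

protected instance DefMap.prod {ι : Type} (s : Finset ι) {f : E → ι → ℝ}
    [hf : ∀ i, DefMap L fun x => f x i] : DefMap L fun x => ∏ i ∈ s, f x i := by
  classical
  induction s using Finset.induction_on with
  | empty => simp only [Finset.prod_empty]; infer_instance
  | insert i s hi ih => simp only [Finset.prod_insert hi]; infer_instance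

instance DefMap.dist_pi {ι : Type} [Fintype ι] {f g : E → ι → ℝ} [DefMap L f] [DefMap L g] :
    DefMap L fun x => dist (f x) (g x) := by
  have h : DefPred L fun z : E × ℝ => 0 ≤ z.2 ∧ (∀ i, |f z.1 i - g z.1 i| ≤ z.2) ∧
    ∀ r' : ℝ, 0 ≤ r' → (∀ i, |f z.1 i - g z.1 i| ≤ r') → z.2 ≤ r' := inferInstance
  refine DefMap.of_graph (fun x r => 0 ≤ r ∧ (∀ i, |f x i - g x i| ≤ r) ∧
    ∀ r', 0 ≤ r' → (∀ i, |f x i - g x i| ≤ r') → r ≤ r') fun x r => ?_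
  simp only [← Real.dist_eq]
  constructor
  · rintro rfl
    exact ⟨dist_nonneg, dist_le_pi_dist _ _, fun r' h0 h => (dist_pi_le_iff h0).2 h⟩
  · rintro ⟨h0, h1, h2⟩
    exact le_antisymm (h2 _ dist_nonneg (dist_le_pi_dist _ _)) ((dist_pi_le_iff h0).2 h1)

protected instance DefMap.dist {f g : E → F} [DefMap L f] [DefMap L g] :
    DefMap L fun x => dist (f x) (g x) := by
  simp only [← (DefSpace.chart (E := F)).dist_eq]
  infer_instance

open Classical in
instance DefMap.sSup_set {P : E → ℝ → Prop} [DefPred L fun z : E × ℝ => P z.1 z.2] :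
    DefMap L fun x => sSup {e | P x e} := by
  refine DefMap.of_graph (fun x r =>
    (((∃ e, P x e) ∧ ∃ b, ∀ e, P x e → e ≤ b) ∧
      (∀ e, P x e → e ≤ r) ∧ ∀ b, (∀ e, P x e → e ≤ b) → r ≤ b) ∨
    (¬ ((∃ e, P x e) ∧ ∃ b, ∀ e, P x e → e ≤ b) ∧ r = 0)) fun x r => ?_
  by_cases h : (∃ e, P x e) ∧ ∃ b, ∀ e, P x e → e ≤ b
  · have hl : IsLUB {e | P x e} (sSup {e | P x e}) := Real.isLUB_sSup h.1 h.2
    simp only [h, true_and, not_true_eq_false, false_and, or_false]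
    constructor
    · rintro rfl
      exact ⟨fun e he => hl.1 he, fun b hb => hl.2 hb⟩
    · rintro ⟨h1, h2⟩
      exact IsLUB.unique ⟨h1, h2⟩ hl
  · simp only [h, false_and, not_false_eq_true, true_and, false_or]
    have : sSup {e | P x e} = 0 := by
      by_cases hne : ∃ e, P x e
      · exact Real.sSup_of_not_bddAbove fun hb => h ⟨hne, hb⟩
      · have : {e | P x e} = ∅ := by
          ext e; simpa using fun he => hne ⟨e, he⟩
        rw [this, Real.sSup_empty]
    rw [this]

/-! Eta-reduced forms of the instances above. -/

section EtaReduced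

instance : DefMap L (Neg.neg : ℝ → ℝ) := by
  have : DefMap L fun x : ℝ => - (x * 1) := inferInstance
  simpa only [mul_one] using this

instance : DefMap L (Inv.inv : ℝ → ℝ) := by
  have : DefMap L fun x : ℝ => (x * 1)⁻¹ := inferInstance
  simpa only [mul_one] using this

end EtaReduced

end Arithmetic

section OneVariable

open Filter

variable {L}

theorem DefPred.def1 {p : ℝ → Prop} (hp : DefPred L p) : Def1 L {x | p x} := by
  have : DefPred L fun v : Fin 1 → ℝ => p (v 0) := inferInstance
  exact this.out

variable [hT : TameField L]

/-- Right germs of definable sets are trivial. -/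
theorem eventually_nhdsGT_or {p : ℝ → Prop} (hp : DefPred L p) (a : ℝ) :
    (∀ᶠ x in 𝓝[>] a, p x) ∨ ∀ᶠ x in 𝓝[>] a, ¬ p x := by
  obtain ⟨b, c, hb, hc, P, J, h⟩ := hT.locallyOMinimal _ hp.def1 a
  have hbc : ∀ᶠ x in 𝓝[>] a, x ∈ Ioo b c :=
    eventually_nhdsWithin_of_eventually_nhds (Ioo_mem_nhds hb hc)
  have hmem (x : ℝ) (hx : x ∈ Ioo b c) : p x ↔ x ∈ P ∨ ∃ q ∈ J, x ∈ Ioo q.1 q.2 := by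
    have := Set.ext_iff.1 h x
    simpa only [mem_inter_iff, hx, and_true, mem_union, Finset.mem_coe, mem_iUnion₂, exists_prop,
      mem_ofPred_eq] using this
  by_cases hJ : ∃ q ∈ J, q.1 ≤ a ∧ a < q.2
  · obtain ⟨q, hq, h1, h2⟩ := hJ
    left
    filter_upwards [hbc, Ioo_mem_nhdsGT h2] with x hx hx2
    exact (hmem x hx).2 (Or.inr ⟨q, hq, lt_of_le_of_lt h1 hx2.1, hx2.2⟩)
  · right
    have hP : ∀ᶠ x in 𝓝[>] a, x ∉ P := by
      have : ∀ᶠ x in 𝓝[≠] a, x ∉ (P : Set ℝ) := by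
        filter_upwards [(P.finite_toSet.sdiff (t := {a})).isClosed.isOpen_compl.mem_nhds
          (show a ∈ ((P : Set ℝ) \ {a})ᶜ by simp) |> mem_nhdsWithin_of_mem_nhds,
          self_mem_nhdsWithin] with x hx hxa hxP
        exact hx ⟨hxP, hxa⟩
      exact this.filter_mono (nhdsWithin_mono _ fun x hx => ne_of_gt hx)
    have hJ' : ∀ᶠ x in 𝓝[>] a, ∀ q ∈ J, x ∉ Ioo q.1 q.2 := by
      rw [eventually_all_finset]
      intro q hq
      rcases lt_or_ge a q.1 with h1 | h1
      · filter_upwards [Ioo_mem_nhdsGT h1] with x hx hx2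
        exact lt_asymm hx.2 hx2.1
      · have h2 : q.2 ≤ a := not_lt.1 fun h2 => hJ ⟨q, hq, h1, h2⟩
        filter_upwards [self_mem_nhdsWithin] with x hx hx2
        exact not_lt_of_ge h2 (lt_trans hx hx2.2)
    filter_upwards [hbc, hP, hJ'] with x hx hx1 hx2 hpx
    rcases (hmem x hx).1 hpx with h | ⟨q, hq, h⟩
    · exact hx1 h
    · exact hx2 q hq h

theorem eventually_nhdsLT_or {p : ℝ → Prop} (hp : DefPred L p) (a : ℝ) :
    (∀ᶠ x in 𝓝[<] a, p x) ∨ ∀ᶠ x in 𝓝[<] a, ¬ p x := by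
  have h : DefPred L fun x : ℝ => p (-x) := inferInstance
  have ht : Tendsto (fun x : ℝ => -x) (𝓝[<] a) (𝓝[>] (-a)) := tendsto_neg_nhdsLT
  rcases eventually_nhdsGT_or h (-a) with h | h
  · left; simpa using ht.eventually h
  · right; simpa using ht.eventually h

theorem eventually_atTop_or {p : ℝ → Prop} (hp : DefPred L p) :
    (∀ᶠ x in atTop, p x) ∨ ∀ᶠ x in atTop, ¬ p x := by
  have h : DefPred L fun x : ℝ => p x⁻¹ := inferInstance
  have ht : Tendsto (fun x : ℝ => x⁻¹) atTop (𝓝[>] 0) := tendsto_inv_atTop_nhdsGT_zero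
  rcases eventually_nhdsGT_or h 0 with h | h
  · left; simpa using ht.eventually h
  · right; simpa using ht.eventually h

theorem eventually_not_nhdsNE {p : ℝ → Prop} (hp : DefPred L p) (hi : interior {x | p x} = ∅)
    (a : ℝ) : ∀ᶠ x in 𝓝[≠] a, ¬ p x := by
  have key (u v : ℝ) (huv : u < v) (h : ∀ x ∈ Ioo u v, p x) : False := by
    have : Ioo u v ⊆ interior {x | p x} := interior_maximal h isOpen_Ioo
    rw [hi] at this
    obtain ⟨w, hw⟩ := nonempty_Ioo.2 huv
    exact this hw
  rw [← nhdsLT_sup_nhdsGT, eventually_sup]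
  constructor
  · refine (eventually_nhdsLT_or hp a).resolve_left fun h => ?_
    obtain ⟨u, hu, h⟩ := (mem_nhdsLT_iff_exists_Ioo_subset).1 h
    exact key u a hu h
  · refine (eventually_nhdsGT_or hp a).resolve_left fun h => ?_
    obtain ⟨u, hu, h⟩ := (mem_nhdsGT_iff_exists_Ioo_subset).1 h
    exact key a u hu h

theorem bddAbove_of_interior_eq_empty {p : ℝ → Prop} (hp : DefPred L p)
    (hi : interior {x | p x} = ∅) : ∃ M, ∀ x, p x → x ≤ M := by
  rcases eventually_atTop_or hp with h | h
  · obtain ⟨M, hM⟩ := eventually_atTop.1 h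
    have : Ioi M ⊆ interior {x | p x} := interior_maximal (fun x hx => hM x hx.le) isOpen_Ioi
    rw [hi] at this
    exact absurd (this (show M + 1 ∈ Ioi M by simp)) (notMem_empty _)
  · obtain ⟨M, hM⟩ := eventually_atTop.1 h
    exact ⟨M, fun x hx => not_lt.1 fun h => hM x h.le hx⟩

/-- A definable subset of the line without interior is finite. -/
theorem finite_of_interior_eq_empty {p : ℝ → Prop} (hp : DefPred L p)
    (hi : interior {x | p x} = ∅) : {x | p x}.Finite := by
  obtain ⟨M, hM⟩ := bddAbove_of_interior_eq_empty hp hi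
  obtain ⟨N, hN⟩ := bddAbove_of_interior_eq_empty (p := fun x => p (-x))
    (L := L) inferInstance (by
    have := (Homeomorph.neg ℝ).preimage_interior {x | p x}
    rw [hi, preimage_empty] at this
    exact this.symm)
  have hsub : {x | p x} ⊆ Icc (-N) M := fun x hx =>
    ⟨by have := hN (-x) (by simpa using hx); linarith, hM x hx⟩
  have hU (a : ℝ) : {x | p x → x = a} ∈ 𝓝 a := by
    have := eventually_not_nhdsNE hp hi a
    rw [eventually_nhdsWithin_iff] at this
    filter_upwards [this] with x hx hpx
    by_contra hne
    exact hx hne hpx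
  obtain ⟨t, -, ht⟩ := (isCompact_Icc (a := -N) (b := M)).elim_nhds_subcover _ fun x _ => hU x
  refine t.finite_toSet.subset fun x hx => ?_
  obtain ⟨a, ha, hxa⟩ := mem_iUnion₂.1 (ht (hsub hx))
  rw [show x = a from hxa hx]
  exact ha

end OneVariable

section Baire

open Filter DefSpace

variable {L}
variable {E F : Type} [PseudoMetricSpace E] [PseudoMetricSpace F] [DefSpace E] [DefSpace F]

instance (priority := low) : CompleteSpace E :=
  ((chart (E := E)).isometry.isUniformInducing.completeSpace_congr
    (chart (E := E)).surjective).2 inferInstance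

instance (priority := low) : T2Space E :=
  (chart (E := E)).toHomeomorph.isEmbedding.t2Space

variable [hT : TameField L]

instance DefPred.eventually_nhds {P : E → F → Prop} {f : E → F}
    [DefPred L fun z : E × F => P z.1 z.2] [DefMap L f] :
    DefPred L fun x => ∀ᶠ y in 𝓝 (f x), P x y := by
  simp only [Metric.eventually_nhds_iff]
  have : DefPred L fun x : E => ∃ ε : ℝ, 0 < ε ∧ ∀ y : F, dist y (f x) < ε → P x y := by
    have : DefPred L fun x : E => ∃ ε : ℝ, 0 < ε ∧ ∀ y : F, ¬ dist y (f x) < ε ∨ P x y :=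
      inferInstance
    simpa only [imp_iff_not_or] using this
  simpa only [← imp_forall_iff, gt_iff_lt] using this

protected theorem DefPred.interior {p : E → Prop} (hp : DefPred L p) :
    DefPred L fun x => x ∈ interior {y | p y} := by
  simp only [mem_interior_iff_mem_nhds]
  exact inferInstanceAs (DefPred L fun x : E => ∀ᶠ y in 𝓝 x, p y)

theorem DefPred.continuousAt {f : E → F} (hf : DefMap L f) :
    DefPred L fun x => ContinuousAt f x := by
  have : DefPred L fun x => ∀ ε : ℝ, 0 < ε → ∀ᶠ y in 𝓝 x, dist (f y) (f x) < ε := inferInstance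
  simpa only [ContinuousAt, Metric.tendsto_nhds, gt_iff_lt] using this

variable (L E) in
/-- Definable sets without interior are meagre. -/
def IsBaireTame : Prop :=
  ∀ p : E → Prop, DefPred L p → interior {x | p x} = ∅ → IsMeagre {x | p x}

theorem exists_rat_Ioo {t : ℝ} {s : Set ℝ} (hs : s ∈ 𝓝 t) :
    ∃ a b : ℚ, t ∈ Ioo (a : ℝ) b ∧ Ioo (a : ℝ) b ⊆ s := by
  obtain ⟨l, u, ⟨hl, hu⟩, h⟩ := mem_nhds_iff_exists_Ioo_subset.1 hs
  obtain ⟨a, ha, ha'⟩ := exists_rat_btwn hl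
  obtain ⟨b, hb, hb'⟩ := exists_rat_btwn hu
  exact ⟨a, b, ⟨ha', hb⟩, (Ioo_subset_Ioo ha.le hb'.le).trans h⟩

theorem IsBaireTame.isMeagre_not_continuousAt (hE : IsBaireTame L E) {h : E → ℝ}
    (hh : DefMap L h) : IsMeagre {x | ¬ ContinuousAt h x} := by
  have hN (a b : ℚ) : IsMeagre {x | h x ∈ Ioo (a : ℝ) b ∧
      x ∉ interior {y | h y ∈ Ioo (a : ℝ) b}} := by
    have h1 : DefPred L fun x => h x ∈ Ioo (a : ℝ) b :=
      inferInstanceAs (DefPred L fun x => a < h x ∧ h x < b)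
    have h2 := h1.interior
    refine hE _ inferInstance (eq_empty_of_forall_notMem fun x hx => ?_)
    exact (interior_subset hx).2 (interior_mono (fun y hy => hy.1) hx)
  refine (isMeagre_iUnion fun a => isMeagre_iUnion (hN a)).mono fun x hx => ?_
  by_contra hcon
  refine hx fun s hs => ?_
  obtain ⟨a, b, hab, hs'⟩ := exists_rat_Ioo hs
  simp only [mem_iUnion, not_exists] at hcon
  have h3 : x ∈ interior {y | h y ∈ Ioo (a : ℝ) b} := by
    by_contra h4
    exact hcon a b ⟨hab, h4⟩
  rw [mem_interior_iff_mem_nhds] at h3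
  exact mem_of_superset h3 fun y hy => hs' hy

theorem IsMeagre.prod_univ {X Y : Type*} [TopologicalSpace X] [TopologicalSpace Y] {s : Set X}
    (hs : IsMeagre s) : IsMeagre {z : X × Y | z.1 ∈ s} :=
  hs.preimage_of_isOpenMap continuous_fst isOpenMap_fst

theorem IsBaireTame.isMeagre_graph (hE : IsBaireTame L E) {h : E → ℝ}
    (hh : DefMap L h) : IsMeagre {z : E × ℝ | z.2 = h z.1} := by
  set G : Set (E × ℝ) := {z | z.2 = h z.1 ∧ ContinuousAt h z.1} with hG
  have hGn : IsNowhereDense G := by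
    refine eq_empty_of_forall_notMem fun w hw => ?_
    obtain ⟨z, hzW, hzG⟩ := mem_closure_iff.1 (interior_subset hw) _ isOpen_interior hw
    have hc : ContinuousAt (fun t : ℝ => (z.1, t)) z.2 := by fun_prop
    have hev := hc.eventually (isOpen_interior.mem_nhds hzW)
    obtain ⟨t, ht, hne⟩ := ((hev.filter_mono nhdsWithin_le_nhds).and
      (self_mem_nhdsWithin (s := {z.2}ᶜ))).exists
    have hcl : (z.1, t) ∈ closure G := interior_subset ht
    refine hne ?_
    rw [mem_closure_iff_clusterPt, clusterPt_principal_iff_frequently] at hcl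
    by_contra hne'
    have hzt : h z.1 ≠ t := fun e => hne' (by rw [mem_singleton_iff, hzG.1, e])
    obtain ⟨A, B, hA, hB, hAB⟩ := t2_separation_nhds hzt
    have h1 : ∀ᶠ w : E × ℝ in 𝓝 (z.1, t), h w.1 ∈ A ∧ w.2 ∈ B := by
      rw [nhds_prod_eq]
      exact (hzG.2.eventually hA).prod_mk hB
    obtain ⟨w, ⟨hw1, -⟩, hw2, hw3⟩ := (hcl.and_eventually h1).exists
    exact disjoint_left.1 hAB hw2 (hw1 ▸ hw3)
  refine (hGn.isMeagre.union (IsMeagre.prod_univ (Y := ℝ)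
    (hE.isMeagre_not_continuousAt hh))).mono fun z hz => ?_
  by_cases hc : ContinuousAt h z.1
  · exact Or.inl ⟨hz, hc⟩
  · exact Or.inr hc

theorem IsBaireTame.prod_real (hE : IsBaireTame L E) : IsBaireTame L (E × ℝ) := by
  intro X hX hi
  have hB (a b : ℚ) (hab : a < b) : IsMeagre {x | ∀ t : ℝ, (a < t ∧ t < b) → X (x, t)} := by
    have : DefPred L fun x => ∀ t : ℝ, (a < t ∧ t < b) → X (x, t) := inferInstance
    refine hE _ this (eq_empty_of_forall_notMem fun x hx => ?_)
    have hsub : interior {x | ∀ t : ℝ, (a < t ∧ t < b) → X (x, t)} ×ˢ Ioo (a : ℝ) b ⊆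
        interior {z | X z} :=
      interior_maximal (fun z hz => (interior_subset hz.1) z.2 hz.2)
        (isOpen_interior.prod isOpen_Ioo)
    rw [hi] at hsub
    obtain ⟨t, ht⟩ := nonempty_Ioo.2 (Rat.cast_lt.2 hab : (a : ℝ) < b)
    exact hsub (mk_mem_prod hx ht)
  have hG (a b : ℚ) : IsMeagre
      {z : E × ℝ | z.2 = sSup {t : ℝ | (a < t ∧ t < b) ∧ X (z.1, t)}} :=
    hE.isMeagre_graph (h := fun x => sSup {t : ℝ | (a < t ∧ t < b) ∧ X (x, t)}) inferInstance
  refine ((isMeagre_iUnion fun a : ℚ => isMeagre_iUnion fun b : ℚ => isMeagre_iUnion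
    fun hab : a < b => IsMeagre.prod_univ (Y := ℝ) (hB a b hab)).union
    (isMeagre_iUnion fun a => isMeagre_iUnion (hG a))).mono fun z hz => ?_
  by_cases hM : ∃ a b : ℚ, ∃ _ : a < b, ∀ t : ℝ, (a < t ∧ t < b) → X (z.1, t)
  · left
    obtain ⟨a, b, hab, h⟩ := hM
    exact mem_iUnion.2 ⟨a, mem_iUnion.2 ⟨b, mem_iUnion.2 ⟨hab, h⟩⟩⟩
  · right
    have hfin : {t | X (z.1, t)}.Finite := by
      refine finite_of_interior_eq_empty (L := L) (p := fun t => X (z.1, t)) inferInstance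
        (eq_empty_of_forall_notMem fun t ht => hM ?_)
      obtain ⟨a, b, hab, h⟩ := exists_rat_Ioo (mem_interior_iff_mem_nhds.1 ht)
      exact ⟨a, b, Rat.cast_lt.1 (hab.1.trans hab.2), fun t ht => h ht⟩
    have hnh : {t | X (z.1, t) → t = z.2} ∈ 𝓝 z.2 := by
      filter_upwards [(hfin.sdiff (t := {z.2})).isClosed.isOpen_compl.mem_nhds
        (show z.2 ∈ ({t | X (z.1, t)} \ {z.2})ᶜ by simp)] with t ht hXt
      by_contra hne
      exact ht ⟨hXt, hne⟩
    obtain ⟨a, b, hab, h⟩ := exists_rat_Ioo hnh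
    refine mem_iUnion₂.2 ⟨a, b, ?_⟩
    have : {t : ℝ | (a < t ∧ t < b) ∧ X (z.1, t)} = {z.2} := by
      ext t
      exact ⟨fun ht => h ht.1 ht.2, fun ht => by rw [mem_singleton_iff.1 ht]; exact ⟨hab, hz⟩⟩
    change z.2 = _
    rw [this, csSup_singleton]

omit hT in
theorem IsBaireTame.of_homeomorph (hE : IsBaireTame L E) (e : E ≃ₜ F) (he : DefMap L e) :
    IsBaireTame L F := by
  intro p hp hi
  have h1 := hE (fun x => p (e x)) (hp.comp_map he) (by
    have := e.preimage_interior {x | p x}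
    rw [hi, preimage_empty] at this
    exact this.symm)
  have h2 := h1.preimage_of_isOpenMap e.symm.continuous e.symm.isOpenMap
  simpa using h2

theorem isBaireTame_pi (ι : Type) [Fintype ι] : IsBaireTame L (ι → ℝ) := by
  refine Fintype.induction_empty_option (P := fun α _ => IsBaireTame L (α → ℝ)) ?_ ?_ ?_ ι
  · intro α β _ e ih
    let _ : Fintype α := Fintype.ofEquiv β e.symm
    refine ih.of_homeomorph ⟨⟨fun v b => v (e.symm b), fun v a => v (e a), fun v => by simp,
      fun v => by simp⟩, by fun_prop, by fun_prop⟩ ?_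
    exact (isReindex_proj e.symm).defMap
  · intro p hp hi
    have : {x | p x} = ∅ := by rwa [(isOpen_discrete {x | p x}).interior_eq] at hi
    rw [this]
    exact IsMeagre.empty
  · intro α _ ih
    refine ih.prod_real.of_homeomorph (F := Option α → ℝ)
      ⟨⟨fun z o => o.elim z.2 z.1, fun v => (fun a => v (some a), v none), fun z => rfl,
        fun v => by ext (_ | a) <;> rfl⟩, ?_, ?_⟩ ?_
    · refine continuous_pi fun o => ?_
      cases o
      · exact continuous_snd
      · rename_i a
        change Continuous fun z : (α → ℝ) × ℝ => z.1 a
        fun_prop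
    · fun_prop
    · refine DefMap.pi fun o => ?_
      cases o
      · exact inferInstanceAs (DefMap L fun z : (α → ℝ) × ℝ => z.2)
      · rename_i a
        exact inferInstanceAs (DefMap L fun z : (α → ℝ) × ℝ => z.1 a)

/-- A definable set without interior is meagre. -/
theorem isBaireTame : IsBaireTame L E :=
  (isBaireTame_pi (idx E)).of_homeomorph (chart (E := E)).symm.toHomeomorph
    isReindex_chart_symm.defMap

end Baire

section Generic

open Filter DefSpace

variable {L}
variable {E F : Type} [PseudoMetricSpace E] [PseudoMetricSpace F] [DefSpace E] [DefSpace F]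

theorem IsOpenDense.isMeagre_not_dense_fiber {X Y : Type*} [TopologicalSpace X]
    [TopologicalSpace Y] [SecondCountableTopology Y] {O : Set (X × Y)} (ho : IsOpen O)
    (hd : Dense O) : IsMeagre {x | ¬ Dense {y | (x, y) ∈ O}} := by
  have hB (b : TopologicalSpace.countableBasis Y) :
      IsMeagre {x : X | ∀ y ∈ b.1, (x, y) ∉ O} := by
    obtain ⟨b, hb⟩ := b
    have hbo : IsOpen b := TopologicalSpace.isOpen_of_mem_countableBasis hb
    have hbn : b.Nonempty := TopologicalSpace.nonempty_of_mem_countableBasis hb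
    have h1 : {x : X | ∀ y ∈ b, (x, y) ∉ O} = (Prod.fst '' (O ∩ Prod.snd ⁻¹' b))ᶜ := by
      ext x
      constructor
      · rintro h ⟨⟨x', y⟩, ⟨h1, h2⟩, rfl⟩
        exact h y h2 h1
      · intro h y hy hO
        exact h ⟨(x, y), ⟨hO, hy⟩, rfl⟩
    have h2 : IsOpen (Prod.fst '' (O ∩ Prod.snd ⁻¹' b)) :=
      isOpenMap_fst _ (ho.inter (hbo.preimage continuous_snd))
    have h3 : Dense (Prod.fst '' (O ∩ Prod.snd ⁻¹' b)) := by
      refine dense_iff_inter_open.2 fun W hW hWn => ?_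
      obtain ⟨z, hz, hzO⟩ := dense_iff_inter_open.1 hd _ (hW.prod hbo) (hWn.prod hbn)
      exact ⟨z.1, hz.1, z, ⟨hzO, hz.2⟩, rfl⟩
    rw [h1]
    refine IsNowhereDense.isMeagre (isClosed_isNowhereDense_iff_compl.2 ?_).2
    rw [compl_compl]
    exact ⟨h2, h3⟩
  refine (isMeagre_iUnion hB).mono fun x hx => ?_
  by_contra hcon
  refine hx ((TopologicalSpace.isBasis_countableBasis Y).dense_iff.2 fun b hb hbn => ?_)
  by_contra hne
  refine hcon (mem_iUnion.2 ⟨⟨b, hb⟩, fun y hy hO => hne ⟨y, hy, hO⟩⟩)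

variable [hT : TameField L]

theorem DefPred.dense_interior_of_isMeagre {p : E → Prop} (hp : DefPred L p)
    (hm : IsMeagre {x | ¬ p x}) : Dense (interior {x | p x}) := by
  by_contra hd
  rw [Metric.dense_iff] at hd
  push Not at hd
  obtain ⟨x0, r, hr, h⟩ := hd
  have h1 : DefPred L fun x => dist x x0 < r ∧ p x := inferInstance
  have h2 : IsMeagre {x | dist x x0 < r ∧ p x} := by
    refine isBaireTame _ h1 (eq_empty_of_forall_notMem fun x hx => ?_)
    have : x ∈ Metric.ball x0 r ∩ interior {x | p x} :=
      ⟨(interior_subset hx).1, interior_mono (fun y hy => hy.2) hx⟩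
    rw [h] at this
    exact this
  have h3 : IsMeagre (Metric.ball x0 r) := by
    refine (h2.union hm).mono fun x hx => ?_
    by_cases hpx : p x
    · exact Or.inl ⟨hx, hpx⟩
    · exact Or.inr hpx
  exact not_isMeagre_of_isOpen Metric.isOpen_ball ⟨x0, Metric.mem_ball_self hr⟩ h3

theorem DefPred.dense_interior {p : E → Prop} (hp : DefPred L p)
    (hi : interior {x | ¬ p x} = ∅) : Dense (interior {x | p x}) :=
  hp.dense_interior_of_isMeagre (isBaireTame _ (DefPred.not (hp := hp)) hi)

theorem DefMap.isMeagre_not_continuousAt {f : E → F} (hf : DefMap L f) :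
    IsMeagre {x | ¬ ContinuousAt f x} := by
  have h (j : idx F) : IsMeagre {x | ¬ ContinuousAt (fun x => chart (f x) j) x} :=
    (isBaireTame (E := E)).isMeagre_not_continuousAt (L := L) inferInstance
  refine (isMeagre_iUnion h).mono fun x hx => ?_
  by_contra hcon
  simp only [mem_iUnion, not_exists, mem_ofPred_eq, not_not] at hcon
  refine hx ?_
  have := continuousAt_pi.2 hcon
  exact ((chart (E := F)).isometry.isUniformInducing.isInducing.continuousAt_iff).2 this

instance DefPred.hasDerivAt {G : E × ℝ → ℝ} [DefMap L G] {a d : E → ℝ} [DefMap L a]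
    [DefMap L d] : DefPred L fun x => HasDerivAt (fun t => G (x, t)) (d x) (a x) := by
  simp only [hasDerivAt_iff_isLittleO, Asymptotics.isLittleO_iff, Real.norm_eq_abs, smul_eq_mul]
  have : DefPred L fun x => ∀ ε : ℝ, 0 < ε → ∀ᶠ t in 𝓝 (a x),
      |G (x, t) - G (x, a x) - (t - a x) * d x| ≤ ε * |t - a x| := inferInstance
  simpa only [← imp_forall_iff] using this

theorem exists_differentiableAt_of_eventually_le {g : ℝ → ℝ} {c d : ℝ} (hcd : c < d)
    (hc : ∀ x ∈ Ioo c d, ContinuousAt g x)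
    (hP : ∀ x ∈ Ioo c d, ∀ᶠ t in 𝓝[>] x, g x ≤ g t) :
    ∃ x ∈ Ioo c d, DifferentiableAt ℝ g x := by
  have hmono : MonotoneOn g (Ioo c d) := by
    intro x hx y hy hxy
    have hsub : Icc x y ⊆ Ioo c d := fun z hz => ⟨hx.1.trans_le hz.1, hz.2.trans_lt hy.2⟩
    have : Icc x y ⊆ {z | g x ≤ g z} := by
      refine IsClosed.Icc_subset_of_forall_exists_gt ?_ (le_refl (g x)) fun z hz w hw => ?_
      · have hcon : ContinuousOn g (Icc x y) := fun z hz => (hc z (hsub hz)).continuousWithinAt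
        have := hcon.preimage_isClosed_of_isClosed isClosed_Icc (isClosed_Ici (a := g x))
        rwa [inter_comm] at this
      · have h1 := hP z (hsub (Ico_subset_Icc_self hz.2))
        obtain ⟨t, ht1, ht2⟩ := (h1.and (Ioc_mem_nhdsGT hw)).exists
        exact ⟨t, le_trans hz.1 ht1, ht2⟩
    exact this ⟨hxy, le_refl y⟩
  have hae := hmono.ae_differentiableWithinAt measurableSet_Ioo
  rw [MeasureTheory.ae_restrict_iff' measurableSet_Ioo] at hae
  by_contra hcon
  push Not at hcon
  have hz : MeasureTheory.volume (Ioo c d) = 0 := by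
    refine MeasureTheory.measure_mono_null (fun x hx => ?_) hae
    intro hx'
    exact hcon x hx ((hx' hx).differentiableAt (isOpen_Ioo.mem_nhds hx))
  simp [Real.volume_Ioo] at hz
  linarith

theorem interior_not_differentiableAt {g : ℝ → ℝ} (hg : DefMap L g) :
    interior {x | ¬ DifferentiableAt ℝ g x} = ∅ := by
  refine eq_empty_of_forall_notMem fun x0 hx0 => ?_
  have hcd := (DefPred.continuousAt hg).dense_interior_of_isMeagre hg.isMeagre_not_continuousAt
  obtain ⟨x1, hx1, hx1'⟩ := dense_iff_inter_open.1 hcd _ isOpen_interior ⟨x0, hx0⟩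
  have hmem := inter_mem (mem_interior_iff_mem_nhds.1 hx1) (mem_interior_iff_mem_nhds.1 hx1')
  have hP : DefPred L fun x => ∃ η : ℝ, 0 < η ∧ ∀ t : ℝ, 0 < t ∧ t < η → g x ≤ g (x + t) :=
    inferInstance
  have hP' (x : ℝ) : (∃ η : ℝ, 0 < η ∧ ∀ t : ℝ, 0 < t ∧ t < η → g x ≤ g (x + t)) ↔
      ∀ᶠ t in 𝓝[>] x, g x ≤ g t := by
    constructor
    · rintro ⟨η, hη, h⟩
      filter_upwards [Ioo_mem_nhdsGT (show x < x + η by linarith)] with t ht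
      have := h (t - x) ⟨by linarith [ht.1], by linarith [ht.2]⟩
      rwa [add_sub_cancel] at this
    · intro h
      obtain ⟨u, hu, h⟩ := (mem_nhdsGT_iff_exists_Ioo_subset).1 h
      refine ⟨u - x, sub_pos.2 hu, fun t ht => h ⟨by linarith, by linarith⟩⟩
  simp only [hP'] at hP
  have hQ (x : ℝ) : (∀ᶠ t in 𝓝[>] x, g x ≤ g t) ∨ ∀ᶠ t in 𝓝[>] x, -g x ≤ -g t := by
    refine (eventually_nhdsGT_or (L := L) (p := fun t => g x ≤ g t) inferInstance x).imp id
      fun h => h.mono fun t ht => ?_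
    linarith [not_le.1 ht]
  rcases eventually_nhdsGT_or hP x1 with h | h
  all_goals
    obtain ⟨u, hu, hu'⟩ := (mem_nhdsGT_iff_exists_Ioo_subset).1
      (inter_mem h (mem_nhdsWithin_of_mem_nhds hmem))
  · obtain ⟨x, hx, hd⟩ := exists_differentiableAt_of_eventually_le (g := g) hu
      (fun x hx => (hu' hx).2.2) (fun x hx => (hu' hx).1)
    exact (hu' hx).2.1 hd
  · obtain ⟨x, hx, hd⟩ := exists_differentiableAt_of_eventually_le (g := fun x => - g x) hu
      (fun x hx => ContinuousAt.neg (hu' hx).2.2) (fun x hx => (hQ x).resolve_left (hu' hx).1)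
    exact (hu' hx).2.1 (by simpa using hd.neg)

end Generic

section GenericSmoothness

open Filter Function

theorem hasFDerivAt_of_partials {ι : Type*} [Fintype ι] [DecidableEq ι] {f : (ι → ℝ) → ℝ}
    {d : ι → (ι → ℝ) → ℝ} {x : ι → ℝ}
    (hd : ∀ i, ∀ᶠ y in 𝓝 x, HasDerivAt (fun t => f (update y i t)) (d i y) (y i))
    (hc : ∀ i, ContinuousAt (d i) x) :
    HasFDerivAt f (∑ i, d i x • ContinuousLinearMap.proj (R := ℝ) (φ := fun _ : ι => ℝ) i) x := by
  have key (s : Finset ι) : (fun h : ι → ℝ => f (x + s.piecewise h 0) - f x - ∑ i ∈ s, d i x * h i)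
      =o[𝓝 0] (fun h => h) := by
    induction s using Finset.induction_on with
    | empty => simp
    | insert i s his ih =>
      have hstep : (fun h : ι → ℝ => f (x + (insert i s).piecewise h 0) - f (x + s.piecewise h 0)
          - d i x * h i) =o[𝓝 0] (fun h => h) := by
        rw [Asymptotics.isLittleO_iff]
        intro ε hε
        have h1 : ∀ᶠ y in 𝓝 x, HasDerivAt (fun t => f (update y i t)) (d i y) (y i) ∧
            |d i y - d i x| ≤ ε := by
          refine (hd i).and ?_
          filter_upwards [Metric.tendsto_nhds.1 (hc i) ε hε] with y hy
          exact hy.le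
        obtain ⟨r, hr, h1⟩ := Metric.eventually_nhds_iff.1 h1
        filter_upwards [Metric.ball_mem_nhds (0 : ι → ℝ) hr] with h hh
        have hh' (j : ι) : |h j| < r := by
          have := (dist_pi_lt_iff hr).1 hh j
          simpa using this
        set y := x + s.piecewise h 0 with hy
        have hyi : y i = x i := by simp [hy, his]
        have hball (t : ℝ) (ht : t ∈ Metric.ball (x i) r) : dist (update y i t) x < r := by
          refine (dist_pi_lt_iff hr).2 fun j => ?_
          by_cases hj : j = i
          · subst hj
            simpa using ht
          · rw [update_of_ne hj, Real.dist_eq, hy, Pi.add_apply, add_sub_cancel_left]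
            by_cases hjs : j ∈ s
            · simpa [hjs] using hh' j
            · simpa [hjs] using hr
        have hder : ∀ t ∈ Metric.ball (x i) r, HasDerivWithinAt
            (fun t => f (update y i t) - d i x * t) (d i (update y i t) - d i x)
            (Metric.ball (x i) r) t := by
          intro t ht
          have h2 := (h1 (hball t ht)).1
          simp only [update_idem, update_self] at h2
          have h3 := h2.sub ((hasDerivAt_id t).const_mul (d i x))
          simp only [mul_one] at h3
          exact h3.hasDerivWithinAt
        have hmvt := Convex.norm_image_sub_le_of_norm_hasDerivWithin_le (C := ε) hder
          (fun t ht => (h1 (hball t ht)).2) (convex_ball _ _) (Metric.mem_ball_self hr)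
          (show x i + h i ∈ Metric.ball (x i) r by simpa using hh' i)
        have e1 : update y i (x i + h i) = x + (insert i s).piecewise h 0 := by
          ext j
          by_cases hj : j = i
          · subst hj; simp
          · simp [hj, hy, Finset.piecewise]
        have e2 : update y i (x i) = y := by rw [← hyi, update_eq_self]
        rw [e1, e2] at hmvt
        calc _ = ‖f (x + (insert i s).piecewise h 0) -
              d i x * (x i + h i) - (f y - d i x * x i)‖ := by
              congr 1; ring
          _ ≤ ε * ‖x i + h i - x i‖ := hmvt
          _ ≤ ε * ‖h‖ := by
              rw [add_sub_cancel_left]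
              gcongr
              exact norm_le_pi_norm h i
      refine (ih.add hstep).congr_left fun h => ?_
      rw [Finset.sum_insert his]
      ring
  rw [hasFDerivAt_iff_isLittleO_nhds_zero]
  refine (key Finset.univ).congr_left fun h => ?_
  simp

theorem contDiffOn_succ_of_partials {ι : Type*} [Fintype ι] [DecidableEq ι] {f : (ι → ℝ) → ℝ}
    {d : ι → (ι → ℝ) → ℝ} {O : Set (ι → ℝ)} (hO : IsOpen O) (k : ℕ)
    (hd : ∀ i, ∀ y ∈ O, HasDerivAt (fun t => f (update y i t)) (d i y) (y i))
    (hc : ∀ i, ContDiffOn ℝ k (d i) O) : ContDiffOn ℝ (k + 1 : ℕ) f O := by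
  push_cast
  refine (contDiffOn_succ_iff_hasFDerivWithinAt_of_uniqueDiffOn hO.uniqueDiffOn).2
    ⟨fun h => absurd h (by simp), fun x => ∑ i, d i x • ContinuousLinearMap.proj i, ?_, ?_⟩
  · exact ContDiffOn.sum fun i _ => (hc i).smul contDiffOn_const
  · intro x hx
    refine (hasFDerivAt_of_partials (fun i => ?_) fun i => ?_).hasFDerivWithinAt
    · filter_upwards [hO.mem_nhds hx] with y hy using hd i y hy
    · exact (hc i).continuousOn.continuousAt (hO.mem_nhds hx)

variable {L} [hT : TameField L]

theorem DefMap.exists_contDiffOn {ι : Type} [Fintype ι] (k : ℕ) {f : (ι → ℝ) → ℝ}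
    (hf : DefMap L f) : ∃ O : Set (ι → ℝ), IsOpen O ∧ Dense O ∧ DefPred L (fun x => x ∈ O) ∧
      ContDiffOn ℝ k f O := by
  classical
  induction k generalizing f with
  | zero =>
    refine ⟨_, isOpen_interior, (DefPred.continuousAt hf).dense_interior_of_isMeagre
      hf.isMeagre_not_continuousAt, (DefPred.continuousAt hf).interior, ?_⟩
    rw [CharP.cast_eq_zero, contDiffOn_zero]
    exact fun x hx => (interior_subset hx : ContinuousAt f x).continuousWithinAt
  | succ k ih =>
    have hup (i : ι) : DefMap L fun z : (ι → ℝ) × ℝ => update z.1 i z.2 := by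
      refine DefMap.pi fun j => ?_
      simp only [update_apply]
      infer_instance
    have hG (i : ι) : DefMap L fun z : (ι → ℝ) × ℝ => f (update z.1 i z.2) := hf.comp_map (hup i)
    have hR (i : ι) : DefPred L fun z : (ι → ℝ) × ℝ =>
        HasDerivAt (fun t => f (update z.1 i t)) z.2 (z.1 i) := by
      have : DefMap L fun w : ((ι → ℝ) × ℝ) × ℝ => f (update w.1.1 i w.2) :=
        (hG i).comp_map (f := fun w : ((ι → ℝ) × ℝ) × ℝ => (w.1.1, w.2)) inferInstance
      exact DefPred.hasDerivAt (G := fun w : ((ι → ℝ) × ℝ) × ℝ => f (update w.1.1 i w.2))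
    have hD (i : ι) : DefPred L fun x : ι → ℝ =>
        ∃ d, HasDerivAt (fun t => f (update x i t)) d (x i) := by
      have := hR i
      exact DefPred.exists
    have hd (i : ι) : DefMap L fun x : ι → ℝ => deriv (fun t => f (update x i t)) (x i) := by
      have := hR i
      have := hD i
      have h : DefPred L fun z : (ι → ℝ) × ℝ =>
          HasDerivAt (fun t => f (update z.1 i t)) z.2 (z.1 i) ∨
          (¬ ∃ d, HasDerivAt (fun t => f (update z.1 i t)) d (z.1 i)) ∧ z.2 = 0 :=
        DefPred.or (hq := DefPred.and
          (hp := (DefPred.not (hp := hD i)).comp_map (f := Prod.fst) DefMap.fst))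
      refine DefMap.of_graph (fun x y => HasDerivAt (fun t => f (update x i t)) y (x i) ∨
        (¬ ∃ d, HasDerivAt (fun t => f (update x i t)) d (x i)) ∧ y = 0) fun x y => ?_
      by_cases hx : DifferentiableAt ℝ (fun t => f (update x i t)) (x i)
      · have hx' : ∃ d, HasDerivAt (fun t => f (update x i t)) d (x i) := ⟨_, hx.hasDerivAt⟩
        simp only [hx', not_true_eq_false, false_and, or_false]
        exact ⟨fun h => h ▸ hx.hasDerivAt, fun h => h.deriv.symm⟩
      · have hx' (d : ℝ) : ¬ HasDerivAt (fun t => f (update x i t)) d (x i) :=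
          fun h => hx h.differentiableAt
        simp [hx', deriv_zero_of_not_differentiableAt hx]
    have hDd (i : ι) : Dense (interior {x : ι → ℝ |
        ∃ d, HasDerivAt (fun t => f (update x i t)) d (x i)}) := by
      refine (hD i).dense_interior (eq_empty_of_forall_notMem fun x hx => ?_)
      have hs : DefMap L fun t : ℝ => f (update x i t) :=
        (hG i).comp_map (f := fun t : ℝ => (x, t)) inferInstance
      have hcont : Continuous fun t : ℝ => update x i t := continuous_const.update i continuous_id
      have hsub : (fun t : ℝ => update x i t) ⁻¹' interior {x : ι → ℝ |
          ¬ ∃ d, HasDerivAt (fun t => f (update x i t)) d (x i)} ⊆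
          interior {t | ¬ DifferentiableAt ℝ (fun t : ℝ => f (update x i t)) t} := by
        refine interior_maximal (fun t ht => ?_) (isOpen_interior.preimage hcont)
        have := interior_subset ht
        simp only [update_idem, update_self, mem_ofPred_eq] at this
        exact fun h => this ⟨_, h.hasDerivAt⟩
      rw [interior_not_differentiableAt hs] at hsub
      exact hsub (show x i ∈ _ by simpa using hx)
    choose O hO1 hO2 hO3 hO4 using fun i => ih (hd i)
    set D : ι → Set (ι → ℝ) := fun i => interior {x : ι → ℝ |
      ∃ d, HasDerivAt (fun t => f (update x i t)) d (x i)} with hDdef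
    have hopen (i : ι) : IsOpen (D i ∩ O i) := isOpen_interior.inter (hO1 i)
    have hmem (i : ι) : DefPred L fun x => x ∈ D i ∧ x ∈ O i :=
      DefPred.and (hp := (hD i).interior) (hq := hO3 i)
    refine ⟨⋂ i, D i ∩ O i, isOpen_iInter_of_finite hopen,
      dense_iInter_of_isOpen hopen fun i => (hDd i).inter_of_isOpen_left (hO2 i) isOpen_interior,
      ?_, ?_⟩
    · simp only [mem_iInter, mem_inter_iff]
      exact DefPred.forall_finite
    · refine contDiffOn_succ_of_partials (isOpen_iInter_of_finite hopen) k
        (d := fun i x => deriv (fun t => f (update x i t)) (x i)) (fun i y hy => ?_) fun i => ?_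
      · obtain ⟨d, hd⟩ := interior_subset (mem_iInter.1 hy i).1
        exact hd.differentiableAt.hasDerivAt
      · exact (hO4 i).mono fun x hx => (mem_iInter.1 hx i).2

end GenericSmoothness

section Tools

open Filter Function

/-- The distance to the set `A`, truncated at `1`. -/
noncomputable def truncDist {M : Type*} [PseudoMetricSpace M] (A : Set M) (y : M) : ℝ :=
  sSup {e | e ≤ 1 ∧ ∀ y', y' ∈ A → e ≤ dist y y'}

section TruncDist

variable {M : Type*} [PseudoMetricSpace M] {A : Set M} {y y' : M} {e : ℝ}

theorem isLUB_truncDist (A : Set M) (y : M) :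
    IsLUB {e | e ≤ 1 ∧ ∀ y', y' ∈ A → e ≤ dist y y'} (truncDist A y) :=
  Real.isLUB_sSup ⟨0, zero_le_one, fun _ _ => dist_nonneg⟩ ⟨1, fun _ h => h.1⟩

theorem le_truncDist (h1 : e ≤ 1) (h : ∀ y' ∈ A, e ≤ dist y y') : e ≤ truncDist A y :=
  (isLUB_truncDist A y).1 ⟨h1, h⟩

theorem truncDist_le_dist (h : y' ∈ A) : truncDist A y ≤ dist y y' :=
  (isLUB_truncDist A y).2 fun _ he => he.2 _ h

theorem truncDist_le_one : truncDist A y ≤ 1 :=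
  (isLUB_truncDist A y).2 fun _ he => he.1

theorem exists_dist_lt_of_truncDist_lt (h : truncDist A y < e) (he : e ≤ 1) :
    ∃ y' ∈ A, dist y y' < e := by
  by_contra! hc
  exact h.not_ge (le_truncDist he hc)

theorem truncDist_le_add : truncDist A y ≤ truncDist A y' + dist y y' := by
  rw [← sub_le_iff_le_add]
  refine le_truncDist ?_ fun z hz => ?_
  · linarith [truncDist_le_one (A := A) (y := y), dist_nonneg (x := y) (y := y')]
  · linarith [truncDist_le_dist (y := y) hz, dist_triangle y y' z]

theorem abs_truncDist_sub_le : |truncDist A y - truncDist A y'| ≤ dist y y' := by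
  rw [abs_le]
  have h1 := truncDist_le_add (A := A) (y := y) (y' := y')
  have h2 := truncDist_le_add (A := A) (y := y') (y' := y)
  rw [dist_comm] at h2
  constructor <;> linarith

theorem continuous_truncDist (A : Set M) : Continuous (truncDist A) :=
  (LipschitzWith.of_dist_le_mul (K := 1) fun y y' => by
    simpa [Real.dist_eq] using abs_truncDist_sub_le).continuous

theorem truncDist_pos (hA : IsOpen Aᶜ) (hy : y ∉ A) : 0 < truncDist A y := by
  obtain ⟨r, hr, h⟩ := Metric.isOpen_iff.1 hA y hy
  refine (lt_min one_pos hr).trans_le (le_truncDist (min_le_left _ _) fun y' hy' => ?_)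
  refine (min_le_right _ _).trans (not_lt.1 fun hlt => h (Metric.mem_ball'.2 hlt) hy')

end TruncDist

theorem contDiff_max_zero_pow (k : ℕ) : ContDiff ℝ k fun t : ℝ => max t 0 ^ (k + 1) := by
  induction k with
  | zero =>
    rw [CharP.cast_eq_zero, contDiff_zero]
    fun_prop
  | succ k ih =>
    have hd (t : ℝ) : HasDerivAt (fun t : ℝ => max t 0 ^ (k + 1 + 1))
        ((k + 2 : ℝ) * max t 0 ^ (k + 1)) t := by
      rcases lt_trichotomy t 0 with ht | rfl | ht
      · rw [max_eq_right ht.le, zero_pow (by simp), mul_zero]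
        refine (hasDerivAt_const t (0 : ℝ)).congr_of_eventuallyEq ?_
        filter_upwards [Iio_mem_nhds ht] with s hs
        rw [max_eq_right hs.le, zero_pow (by simp)]
      · rw [max_self, zero_pow (by simp), mul_zero, hasDerivAt_iff_isLittleO]
        simp only [max_self, sub_zero, smul_zero]
        rw [zero_pow (by simp)]
        simp only [sub_zero]
        have h1 : (fun t : ℝ => max t 0) =O[𝓝 0] fun t => t :=
          Asymptotics.isBigO_of_le _ fun t => by
            rw [Real.norm_eq_abs, Real.norm_eq_abs, abs_of_nonneg (le_max_right _ _)]
            exact max_le (le_abs_self t) (abs_nonneg t)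
        exact (h1.pow (k + 2)).trans_isLittleO (Asymptotics.isLittleO_pow_id (by lia))
      · rw [max_eq_left ht.le]
        refine HasDerivAt.congr_of_eventuallyEq (f := fun t => t ^ (k + 2)) ?_ ?_
        · have := hasDerivAt_pow (k + 2) t
          push_cast at this
          exact this
        · filter_upwards [Ioi_mem_nhds ht] with s hs
          rw [max_eq_left (le_of_lt hs)]
    push_cast
    refine contDiff_succ_iff_deriv.2 ⟨fun t => (hd t).differentiableAt, by simp, ?_⟩
    rw [show deriv (fun t : ℝ => max t 0 ^ (k + 1 + 1)) = fun t => (k + 2 : ℝ) * max t 0 ^ (k + 1)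
      from funext fun t => (hd t).deriv]
    exact contDiff_const.mul ih

variable {L} [hT : TameField L]

variable {E F : Type} [PseudoMetricSpace E] [PseudoMetricSpace F] [DefSpace E] [DefSpace F]

instance DefMap.truncDist {P : E → F → Prop} {g : E → F} [DefPred L fun z : E × F => P z.1 z.2]
    [DefMap L g] : DefMap L fun x => truncDist {y | P x y} (g x) := by
  simp only [Paper.truncDist, mem_ofPred_eq]
  have : DefPred L fun w : (E × ℝ) × F => P w.1.1 w.2 → w.1.2 ≤ dist (g w.1.1) w.2 := by
    have : DefMap L fun w : (E × ℝ) × F => g w.1.1 := inferInstance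
    infer_instance
  have : DefPred L fun z : E × ℝ => z.2 ≤ 1 ∧ ∀ y', P z.1 y' → z.2 ≤ dist (g z.1) y' :=
    inferInstance
  infer_instance

variable (L) in
/-- Definable bump functions of class `C^k`. -/
theorem exists_bump (k : ℕ) : ∃ β : ℝ → ℝ, DefMap L β ∧ ContDiff ℝ k β ∧
    (∀ t, 0 ≤ β t ∧ β t ≤ 1) ∧ (∀ t, |t| ≤ 1 / 2 → β t = 1) ∧ ∀ t, 1 ≤ |t| → β t = 0 := by
  set p : ℝ → ℝ := fun t => max t 0 ^ (k + 1) with hp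
  have hp0 (t : ℝ) : 0 ≤ p t := pow_nonneg (le_max_right _ _) _
  have hpneg (t : ℝ) (ht : t ≤ 0) : p t = 0 := by simp [hp, max_eq_right ht]
  have hppos (t : ℝ) (ht : 0 < t) : 0 < p t := pow_pos (lt_max_of_lt_left ht) _
  have hden (t : ℝ) : 0 < p (1 - t ^ 2) + p (t ^ 2 - 1 / 4) := by
    rcases le_or_gt (t ^ 2) (1 / 2) with h | h
    · exact add_pos_of_pos_of_nonneg (hppos _ (by linarith)) (hp0 _)
    · exact add_pos_of_nonneg_of_pos (hp0 _) (hppos _ (by linarith))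
  have hC : ContDiff ℝ k p := contDiff_max_zero_pow k
  have h1 : ContDiff ℝ k fun t => p (1 - t ^ 2) := hC.comp (by fun_prop)
  have h2 : ContDiff ℝ k fun t => p (t ^ 2 - 1 / 4) := hC.comp (by fun_prop)
  refine ⟨fun t => p (1 - t ^ 2) / (p (1 - t ^ 2) + p (t ^ 2 - 1 / 4)), ?_,
    h1.div (h1.add h2) fun t => (hden t).ne', fun t => ⟨div_nonneg (hp0 _) (hden t).le,
    (div_le_one (hden t)).2 (le_add_of_nonneg_right (hp0 _))⟩, fun t ht => ?_, fun t ht => ?_⟩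
  · infer_instance
  · have : t ^ 2 ≤ 1 / 4 := by
      rw [← sq_abs]; nlinarith [abs_nonneg t]
    have h0 := hden t
    dsimp only
    rw [hpneg (t ^ 2 - 1 / 4) (by linarith), add_zero] at h0 ⊢
    exact div_self h0.ne'
  · have : 1 ≤ t ^ 2 := by
      rw [← sq_abs]; nlinarith [abs_nonneg t]
    dsimp only
    rw [hpneg (1 - t ^ 2) (by linarith), zero_div]

theorem DefMap.exists_contDiffOn_prod {α κ : Type} [Fintype α] [Fintype κ] (k : ℕ) {J : Type}
    [Finite J] {f : J → (α → ℝ) × (κ → ℝ) → ℝ} (hf : ∀ j, DefMap L (f j)) :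
    ∃ O : Set ((α → ℝ) × (κ → ℝ)), IsOpen O ∧ Dense O ∧ DefPred L (fun z => z ∈ O) ∧
      ∀ j, ContDiffOn ℝ k (f j) O := by
  let e : (α → ℝ) × (κ → ℝ) ≃ₜ (α ⊕ κ → ℝ) := Homeomorph.sumArrowHomeomorphProdArrow.symm
  have he : IsReindex e := ⟨id, fun z j => rfl⟩
  have heC : ContDiff ℝ k e := by
    refine contDiff_pi.2 fun j => ?_
    rcases j with j | j
    · exact (by fun_prop : ContDiff ℝ k fun z : (α → ℝ) × (κ → ℝ) => z.1 j)
    · exact (by fun_prop : ContDiff ℝ k fun z : (α → ℝ) × (κ → ℝ) => z.2 j)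
  have he' : IsReindex e.symm := ⟨id, fun z j => by rcases j with j | j <;> rfl⟩
  choose O hO1 hO2 hO3 hO4 using fun j => DefMap.exists_contDiffOn (L := L) k
    ((hf j).comp_map he'.defMap)
  refine ⟨e ⁻¹' ⋂ j, O j, (isOpen_iInter_of_finite hO1).preimage e.continuous,
    (dense_iInter_of_isOpen hO1 hO2).preimage e.isOpenMap, ?_, fun j => ?_⟩
  · have : DefPred L fun z => ∀ j, z ∈ O j := DefPred.forall_finite
    simpa only [mem_preimage, mem_iInter] using this.reindex he
  · have := (hO4 j).comp (heC.contDiffOn (s := e ⁻¹' ⋂ j, O j)) fun z hz => mem_iInter.1 hz j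
    simpa [Function.comp_def] using this

end Tools

section Sections

open Filter Function

variable {L} [hT : TameField L]
variable {α κ : Type} [Fintype α] [Fintype κ]
variable {Z U : Set ((α → ℝ) × (κ → ℝ))} {f δ : (α → ℝ) × (κ → ℝ) → ℝ}

/-- If all coordinate projections of the fibres of `Z` are thin, almost all fibres are finite. -/
theorem isMeagre_not_finite_fiber (hZ : DefPred L fun z => z ∈ Z)
    (hproj : ∀ j, interior {w : (α → ℝ) × ℝ | ∃ y, (w.1, y) ∈ Z ∧ y j = w.2} = ∅) :
    IsMeagre {x | ¬ {y | (x, y) ∈ Z}.Finite} := by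
  have hP (j : κ) : DefPred L fun w : (α → ℝ) × ℝ => ∃ y, (w.1, y) ∈ Z ∧ y j = w.2 :=
    inferInstance
  have hd (j : κ) := DefPred.dense_interior (DefPred.not (hp := hP j)) (by
    simpa only [not_not] using hproj j)
  refine (isMeagre_iUnion fun j =>
    IsOpenDense.isMeagre_not_dense_fiber isOpen_interior (hd j)).mono fun x hx => ?_
  by_contra hc
  simp only [mem_iUnion, mem_ofPred_eq, not_exists, not_not] at hc
  refine hx ((Finite.pi' (t := fun j => {t : ℝ | ∃ y, (x, y) ∈ Z ∧ y j = t})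
    fun j => ?_).subset fun y hy j => ⟨y, hy, rfl⟩)
  have hPx : DefPred L fun t : ℝ => ∃ y, (x, y) ∈ Z ∧ y j = t :=
    (hP j).comp_map (f := fun t : ℝ => (x, t)) inferInstance
  refine finite_of_interior_eq_empty hPx (eq_empty_of_forall_notMem fun t ht => ?_)
  obtain ⟨s, hs, hs'⟩ := (hc j).exists_mem_open isOpen_interior ⟨t, ht⟩
  obtain ⟨y, hy⟩ := interior_subset hs'
  exact interior_subset hs y hy

/-- Points of the fibre `Z_x` are `4e`-separated and `f` varies by less than `δ` on their
`e`-balls, which lie in `U`. -/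
def IsTubeRadius (Z U : Set ((α → ℝ) × (κ → ℝ))) (f δ : (α → ℝ) × (κ → ℝ) → ℝ) (x : α → ℝ)
    (e : ℝ) : Prop :=
  (∀ y y', (x, y) ∈ Z → (x, y') ∈ Z → dist y y' < 4 * e → y = y') ∧
    ∀ y y', (x, y) ∈ Z → dist y y' < e → (x, y') ∈ U ∧ |f (x, y) - f (x, y')| < δ (x, y')

/-- The supremum of the radii `e ≤ 1` satisfying `IsTubeRadius`. -/
noncomputable def tubeRadius (Z U : Set ((α → ℝ) × (κ → ℝ))) (f δ : (α → ℝ) × (κ → ℝ) → ℝ)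
    (x : α → ℝ) : ℝ :=
  sSup {e | e ≤ 1 ∧ IsTubeRadius Z U f δ x e}

omit [Fintype α] in
theorem IsTubeRadius.mono {x : α → ℝ} {e e' : ℝ} (h : IsTubeRadius Z U f δ x e) (he : e' ≤ e) :
    IsTubeRadius Z U f δ x e' :=
  ⟨fun y y' hy hy' hd => h.1 y y' hy hy' (by linarith),
    fun y y' hy hd => h.2 y y' hy (hd.trans_le he)⟩

omit [Fintype α] in
theorem isLUB_tubeRadius (x : α → ℝ) :
    IsLUB {e | e ≤ 1 ∧ IsTubeRadius Z U f δ x e} (tubeRadius Z U f δ x) := by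
  refine Real.isLUB_sSup ⟨0, zero_le_one, fun y y' _ _ h => ?_, fun y y' _ h => ?_⟩
    ⟨1, fun _ h => h.1⟩
  · exact absurd h (by simp)
  · exact absurd h (by simp)

omit [Fintype α] in
theorem tubeRadius_le_one (x : α → ℝ) : tubeRadius Z U f δ x ≤ 1 :=
  (isLUB_tubeRadius x).2 fun _ h => h.1

omit [Fintype α] in
theorem isTubeRadius_of_lt {x : α → ℝ} {e : ℝ} (h : e < tubeRadius Z U f δ x) :
    IsTubeRadius Z U f δ x e := by
  obtain ⟨e', he', hlt⟩ := (lt_isLUB_iff (isLUB_tubeRadius x)).1 h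
  exact he'.2.mono hlt.le

omit [Fintype α] in
theorem eq_of_dist_lt_tubeRadius {x : α → ℝ} {y y' y'' : κ → ℝ} (h' : (x, y') ∈ Z)
    (h'' : (x, y'') ∈ Z) (hd' : dist y y' < tubeRadius Z U f δ x)
    (hd'' : dist y y'' < tubeRadius Z U f δ x) : y' = y'' := by
  obtain ⟨e, he, he'⟩ := exists_between (max_lt hd' hd'')
  refine (isTubeRadius_of_lt he').1 y' y'' h' h'' ?_
  have := dist_triangle_left y' y'' y
  have h1 := (le_max_left _ _).trans_lt he
  have h2 := (le_max_right _ _).trans_lt he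
  have h3 := (dist_nonneg (x := y) (y := y')).trans_lt h1
  linarith

omit [Fintype α] in
theorem tubeRadius_pos (hU : IsOpen U) (hZU : Z ⊆ U) (hf : ContinuousOn f U)
    (hδ : ContinuousOn δ U) (hδ0 : ∀ z ∈ U, 0 < δ z) {x : α → ℝ}
    (hx : {y | (x, y) ∈ Z}.Finite) : 0 < tubeRadius Z U f δ x := by
  have h1 : ∀ᶠ e in 𝓝[>] (0 : ℝ), ∀ y ∈ {y | (x, y) ∈ Z}, ∀ y' ∈ {y | (x, y) ∈ Z},
      dist y y' < 4 * e → y = y' := by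
    refine (eventually_all_finite hx).2 fun y _ => (eventually_all_finite hx).2 fun y' _ => ?_
    by_cases hyy : y = y'
    · simp [hyy]
    · filter_upwards [Ioo_mem_nhdsGT (show (0 : ℝ) < dist y y' / 4 by
        have := dist_pos.2 hyy; positivity)] with e he hd
      linarith [he.2]
  have h2 : ∀ᶠ e in 𝓝[>] (0 : ℝ), ∀ y ∈ {y | (x, y) ∈ Z}, ∀ y', dist y y' < e →
      (x, y') ∈ U ∧ |f (x, y) - f (x, y')| < δ (x, y') := by
    refine (eventually_all_finite hx).2 fun y hy => ?_
    have hyU : U ∈ 𝓝 (x, y) := hU.mem_nhds (hZU hy)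
    have hc : ContinuousAt (fun y' => (x, y')) y := by fun_prop
    have hfc : ContinuousAt (fun y' => f (x, y')) y :=
      ContinuousAt.comp (hf.continuousAt hyU) hc
    have hδc : ContinuousAt (fun y' => δ (x, y')) y :=
      ContinuousAt.comp (hδ.continuousAt hyU) hc
    have hlt : ∀ᶠ y' in 𝓝 y, |f (x, y) - f (x, y')| < δ (x, y') := by
      refine (continuousAt_const.sub hfc).abs.eventually_lt hδc ?_
      simpa using hδ0 _ (hZU hy)
    obtain ⟨r, hr, h⟩ := Metric.eventually_nhds_iff.1 ((hc.eventually hyU).and hlt)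
    filter_upwards [Ioo_mem_nhdsGT hr] with e he y' hd
    exact h (by rw [dist_comm]; exact hd.trans he.2)
  obtain ⟨e, ⟨h1, h2⟩, he⟩ := ((h1.and h2).and (Ioo_mem_nhdsGT one_pos)).exists
  exact he.1.trans_le ((isLUB_tubeRadius x).1
    ⟨he.2.le, fun y y' hy hy' => h1 y hy y' hy', fun y y' hy => h2 y hy y'⟩)

instance DefMap.tubeRadius [DefPred L fun z => z ∈ Z] [DefPred L fun z => z ∈ U] [DefMap L f]
    [DefMap L δ] : DefMap L (tubeRadius Z U f δ) := by
  have h : DefPred L fun z : (α → ℝ) × ℝ => z.2 ≤ 1 ∧ IsTubeRadius Z U f δ z.1 z.2 := by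
    unfold IsTubeRadius
    infer_instance
  exact DefMap.sSup_set (P := fun x e => e ≤ 1 ∧ IsTubeRadius Z U f δ x e)

open Classical in
/-- The point of the fibre `Z_x` at distance less than `ρ x` from `y`, if unique. -/
noncomputable def nearPoint (Z : Set ((α → ℝ) × (κ → ℝ))) (ρ : (α → ℝ) → ℝ)
    (z : (α → ℝ) × (κ → ℝ)) : κ → ℝ :=
  if h : ∃! y', (z.1, y') ∈ Z ∧ dist z.2 y' < ρ z.1 then h.choose else 0

omit [Fintype α] in
theorem nearPoint_eq {ρ : (α → ℝ) → ℝ}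
    (hρ : ∀ x y y' y'', (x, y') ∈ Z → (x, y'') ∈ Z → dist y y' < ρ x → dist y y'' < ρ x → y' = y'')
    {x : α → ℝ} {y y' : κ → ℝ} (h : (x, y') ∈ Z) (hd : dist y y' < ρ x) :
    nearPoint Z ρ (x, y) = y' := by
  have hu : ∃! y', (x, y') ∈ Z ∧ dist y y' < ρ x :=
    ⟨y', ⟨h, hd⟩, fun y'' h'' => hρ x y y'' y' h''.1 h h''.2 hd⟩
  rw [nearPoint, dif_pos hu]
  exact hu.unique hu.choose_spec.1 ⟨h, hd⟩

instance DefMap.nearPoint [DefPred L fun z => z ∈ Z] {ρ : (α → ℝ) → ℝ} [DefMap L ρ] :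
    DefMap L (nearPoint Z ρ) := by
  have h1 : DefPred L fun w : ((α → ℝ) × (κ → ℝ)) × (κ → ℝ) =>
    (w.1.1, w.2) ∈ Z ∧ dist w.1.2 w.2 < ρ w.1.1 := inferInstance
  have h2 : DefPred L fun w : ((α → ℝ) × (κ → ℝ)) × (κ → ℝ) =>
    ∀ y', (w.1.1, y') ∈ Z ∧ dist w.1.2 y' < ρ w.1.1 → y' = w.2 := inferInstance
  have h3 : DefPred L fun z : (α → ℝ) × (κ → ℝ) =>
      ∃ y', ((z.1, y') ∈ Z ∧ dist z.2 y' < ρ z.1) ∧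
        ∀ y'', (z.1, y'') ∈ Z ∧ dist z.2 y'' < ρ z.1 → y'' = y' :=
    DefPred.exists (h := DefPred.and (hp := h1) (hq := h2))
  have h4 : DefPred L fun w : ((α → ℝ) × (κ → ℝ)) × (κ → ℝ) =>
      ¬ (∃ y', ((w.1.1, y') ∈ Z ∧ dist w.1.2 y' < ρ w.1.1) ∧
        ∀ y'', (w.1.1, y'') ∈ Z ∧ dist w.1.2 y'' < ρ w.1.1 → y'' = y') ∧ w.2 = 0 :=
    DefPred.and (hp := (DefPred.not (hp := h3)).comp_map (f := Prod.fst) DefMap.fst)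
  refine DefMap.of_graph (h := DefPred.or (hp := DefPred.and (hp := h1) (hq := h2)) (hq := h4))
    (fun z w => (((z.1, w) ∈ Z ∧ dist z.2 w < ρ z.1) ∧
      ∀ y', (z.1, y') ∈ Z ∧ dist z.2 y' < ρ z.1 → y' = w) ∨
      (¬ (∃ y', ((z.1, y') ∈ Z ∧ dist z.2 y' < ρ z.1) ∧
        ∀ y'', (z.1, y'') ∈ Z ∧ dist z.2 y'' < ρ z.1 → y'' = y')) ∧ w = 0) fun z w => ?_
  by_cases h : ∃! y', (z.1, y') ∈ Z ∧ dist z.2 y' < ρ z.1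
  · rw [Paper.nearPoint, dif_pos h]
    have hs := h.choose_spec
    have h' : ∃ y', ((z.1, y') ∈ Z ∧ dist z.2 y' < ρ z.1) ∧
        ∀ y'', (z.1, y'') ∈ Z ∧ dist z.2 y'' < ρ z.1 → y'' = y' := h
    simp only [h', not_true_eq_false, false_and, or_false]
    exact ⟨fun e => e ▸ hs, fun hw => h.unique hw.1 hs.1⟩
  · rw [Paper.nearPoint, dif_neg h]
    have h' (y') : ¬ (((z.1, y') ∈ Z ∧ dist z.2 y' < ρ z.1) ∧
        ∀ y'', (z.1, y'') ∈ Z ∧ dist z.2 y'' < ρ z.1 → y'' = y') := fun hy => h ⟨y', hy⟩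
    simp only [h', false_or, exists_false, not_false_eq_true, true_and]

end Sections

section Gluing

open Filter Function

variable {L} [hT : TameField L]
variable {α κ : Type} [Fintype α] [Fintype κ]
variable {Z U : Set ((α → ℝ) × (κ → ℝ))} {f δ : (α → ℝ) × (κ → ℝ) → ℝ}

/-- `x` is a regular base point: near `x` the fibres of `Z` are given by sections of class `C^k`
along which `f` is of class `C^k`, and the fibrewise distance to `Z` is continuous over `x`. -/
structure IsRegularBase (k : ℕ) (Z : Set ((α → ℝ) × (κ → ℝ))) (f : (α → ℝ) × (κ → ℝ) → ℝ)
    (ρ : (α → ℝ) → ℝ) (x : α → ℝ) : Prop where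
  pos : 0 < ρ x
  continuousAt : ContinuousAt ρ x
  continuousAt_truncDist (y : κ → ℝ) :
    ContinuousAt (fun z : (α → ℝ) × (κ → ℝ) => truncDist {y' | (z.1, y') ∈ Z} z.2) (x, y)
  exists_section (y : κ → ℝ) (hy : (x, y) ∈ Z) : ∃ γ : (α → ℝ) → κ → ℝ, ContDiffAt ℝ k γ x ∧
    γ x = y ∧ (∀ᶠ x' in 𝓝 x, (x', γ x') ∈ Z) ∧ ContDiffAt ℝ k (fun x' => f (x', γ x')) x

theorem exists_isRegularBase (k : ℕ) (hZ : DefPred L fun z => z ∈ Z) (hf : DefMap L f)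
    {ρ : (α → ℝ) → ℝ} (hρd : DefMap L ρ) (hρ1 : ∀ x, ρ x ≤ 1)
    (hρ : ∀ x y y' y'', (x, y') ∈ Z → (x, y'') ∈ Z → dist y y' < ρ x → dist y y'' < ρ x → y' = y'')
    (hm : IsMeagre {x | ¬ 0 < ρ x}) :
    ∃ V : Set (α → ℝ), IsOpen V ∧ Dense V ∧ DefPred L (fun x => x ∈ V) ∧
      ∀ x ∈ V, IsRegularBase k Z f ρ x := by
  set T : (α → ℝ) × (κ → ℝ) → ℝ := fun z => truncDist {y' | (z.1, y') ∈ Z} z.2 with hT'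
  set N := nearPoint Z ρ with hN
  have hNd : DefMap L N := DefMap.nearPoint
  have hTd : DefMap L T := DefMap.truncDist (P := fun (z : (α → ℝ) × (κ → ℝ)) y' => (z.1, y') ∈ Z)
  have hHd : DefMap L fun z : (α → ℝ) × (κ → ℝ) => f (z.1, N z) := inferInstance
  obtain ⟨O₁, hO₁, hO₁d, hO₁p, hO₁C⟩ := DefMap.exists_contDiffOn_prod (L := L) k (J := Bool)
    (f := fun b => bif b then T else fun z => f (z.1, N z)) (fun b => by cases b <;> simpa)
  obtain ⟨O₂, hO₂, hO₂d, hO₂p, hO₂C⟩ := DefMap.exists_contDiffOn_prod (L := L) k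
    (f := fun j z => N z j) (fun j => inferInstance)
  have hO : IsOpen (O₁ ∩ O₂) := hO₁.inter hO₂
  have hOd : Dense (O₁ ∩ O₂) := hO₁d.inter_of_isOpen_left hO₂d hO₁
  have hOp : DefPred L fun z => z ∈ O₁ ∧ z ∈ O₂ := inferInstance
  have hdense : DefPred L fun x => Dense {y | (x, y) ∈ O₁ ∩ O₂} := by
    have : DefPred L fun x : α → ℝ => ∀ y : κ → ℝ, ∀ r : ℝ, 0 < r →
      ∃ y' : κ → ℝ, dist y' y < r ∧ (x, y') ∈ O₁ ∧ (x, y') ∈ O₂ := inferInstance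
    simpa only [Metric.dense_iff, gt_iff_lt, Set.Nonempty, mem_inter_iff, Metric.mem_ball,
      mem_ofPred_eq] using this
  have hcont := DefPred.continuousAt hρd
  have hV : DefPred L fun x => 0 < ρ x ∧ ContinuousAt ρ x ∧ Dense {y | (x, y) ∈ O₁ ∩ O₂} :=
    inferInstance
  refine ⟨_, isOpen_interior, hV.dense_interior_of_isMeagre ?_, hV.interior, fun x hx => ?_⟩
  · refine ((hm.union hρd.isMeagre_not_continuousAt).union
      (IsOpenDense.isMeagre_not_dense_fiber hO hOd)).mono fun x hx => ?_
    simp only [mem_union, mem_ofPred_eq] at hx ⊢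
    tauto
  obtain ⟨hpos, hρc, hdx⟩ := interior_subset hx
  have hTat (z) (hz : z ∈ O₁ ∩ O₂) : ContinuousAt T z :=
    (hO₁C true).continuousOn.continuousAt (hO₁.mem_nhds hz.1)
  refine ⟨hpos, hρc, fun y => ?_, fun y hy => ?_⟩
  · rw [Metric.continuousAt_iff']
    intro ε hε
    obtain ⟨y₁, hy₁, hd₁⟩ := Metric.dense_iff.1 hdx y (ε / 4) (by positivity)
    rw [Metric.mem_ball] at hy₁
    have h1 : ContinuousAt (fun x' => T (x', y₁)) x :=
      ContinuousAt.comp (f := fun x' : α → ℝ => (x', y₁)) (hTat _ hd₁) (by fun_prop)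
    have h2 := Metric.continuousAt_iff'.1 h1 (ε / 4) (by positivity)
    rw [nhds_prod_eq]
    filter_upwards [h2.prod_mk (Metric.ball_mem_nhds y (show 0 < ε / 4 by positivity))]
      with z ⟨hz1, hz2⟩
    have h3 : |T z - T (z.1, y₁)| ≤ dist z.2 y₁ := abs_truncDist_sub_le
    have h4 : |T (x, y₁) - T (x, y)| ≤ dist y₁ y := abs_truncDist_sub_le
    rw [Real.dist_eq] at hz1 ⊢
    have h5 := dist_triangle_right z.2 y₁ y
    rw [abs_lt] at hz1 ⊢
    rw [abs_le] at h3 h4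
    constructor <;> linarith
  · obtain ⟨y₁, hy₁, hd₁⟩ := Metric.dense_iff.1 hdx y (ρ x) hpos
    rw [Metric.mem_ball] at hy₁
    have hlt : T (x, y₁) < ρ x := (truncDist_le_dist (A := {y' | (x, y') ∈ Z}) hy).trans_lt hy₁
    have h1 : ContinuousAt (fun x' => T (x', y₁)) x :=
      ContinuousAt.comp (f := fun x' : α → ℝ => (x', y₁)) (hTat _ hd₁) (by fun_prop)
    have hC : ContDiffAt ℝ k (fun x' : α → ℝ => (x', y₁)) x := by fun_prop
    have hev : ∀ᶠ x' in 𝓝 x, (x', N (x', y₁)) ∈ Z := by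
      filter_upwards [h1.eventually_lt hρc hlt] with x' hx'
      obtain ⟨y', hy', hd'⟩ := exists_dist_lt_of_truncDist_lt hx' (hρ1 x')
      rwa [hN, nearPoint_eq hρ hy' hd']
    refine ⟨fun x' => N (x', y₁), ?_, nearPoint_eq hρ hy hy₁, hev, ?_⟩
    · refine contDiffAt_pi.2 fun j => ?_
      exact ((hO₂C j).contDiffAt (hO₂.mem_nhds hd₁.2)).comp x hC
    · exact ContDiffAt.comp (g := fun z => f (z.1, N z)) x
        ((hO₁C false).contDiffAt (hO₁.mem_nhds hd₁.1)) hC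

variable (L) in
/-- Definable continuous functions on definable open subsets of `ℝ^ι` have definable
approximations of class `C^k`. -/
def HasApprox (k : ℕ) (ι : Type) [Fintype ι] : Prop :=
  ∀ (U : Set (ι → ℝ)) (f δ : (ι → ℝ) → ℝ), DefPred L (fun x => x ∈ U) → IsOpen U → DefMap L f →
    ContinuousOn f U → DefMap L δ → ContinuousOn δ U → (∀ x ∈ U, 0 < δ x) →
    ∃ g : (ι → ℝ) → ℝ, DefMap L g ∧ ContDiffOn ℝ k g U ∧ ∀ x ∈ U, |g x - f x| < δ x

open Classical in
/-- The function `f`, made constant in the fibre direction near `Z` over `V` by means of the bump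
function `β` at scale `ε`. -/
noncomputable def tubeGlue (V : Set (α → ℝ)) (Z : Set ((α → ℝ) × (κ → ℝ)))
    (f : (α → ℝ) × (κ → ℝ) → ℝ) (ρ ε : (α → ℝ) → ℝ) (β : ℝ → ℝ) (z : (α → ℝ) × (κ → ℝ)) : ℝ :=
  if z.1 ∈ V ∧ ∃ y', (z.1, y') ∈ Z ∧ dist z.2 y' < ρ z.1 then
    f z + (∏ j, β ((z.2 j - nearPoint Z ρ z j) / ε z.1)) * (f (z.1, nearPoint Z ρ z) - f z)
  else f z

theorem DefMap.tubeGlue {V : Set (α → ℝ)} {ρ ε : (α → ℝ) → ℝ} {β : ℝ → ℝ}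
    (hV : DefPred L fun x => x ∈ V) (hZ : DefPred L fun z => z ∈ Z) (hf : DefMap L f)
    (hρ : DefMap L ρ) (hε : DefMap L ε) (hβ : DefMap L β) :
    DefMap L (tubeGlue V Z f ρ ε β) := by
  unfold Paper.tubeGlue
  have hN : DefMap L (Paper.nearPoint Z ρ) := DefMap.nearPoint
  have h1 (j : κ) : DefMap L fun z : (α → ℝ) × (κ → ℝ) =>
      (z.2 j - Paper.nearPoint Z ρ z j) / ε z.1 := inferInstance
  have h2 (j : κ) : DefMap L fun z : (α → ℝ) × (κ → ℝ) =>
      β ((z.2 j - Paper.nearPoint Z ρ z j) / ε z.1) := inferInstance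
  have h3 : DefPred L fun z : (α → ℝ) × (κ → ℝ) =>
      z.1 ∈ V ∧ ∃ y', (z.1, y') ∈ Z ∧ dist z.2 y' < ρ z.1 := inferInstance
  have h4 : DefMap L fun z : (α → ℝ) × (κ → ℝ) => f (z.1, Paper.nearPoint Z ρ z) := inferInstance
  have h5 := DefMap.prod (L := L) Finset.univ
    (f := fun (z : (α → ℝ) × (κ → ℝ)) j => β ((z.2 j - Paper.nearPoint Z ρ z j) / ε z.1))
  classical exact DefMap.ite

/-- The data of the gluing construction over the regular base `V`. -/
structure IsGluing (k : ℕ) (V : Set (α → ℝ)) (Z U : Set ((α → ℝ) × (κ → ℝ)))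
    (f : (α → ℝ) × (κ → ℝ) → ℝ) (ρ ε : (α → ℝ) → ℝ) (β : ℝ → ℝ) : Prop where
  isOpen_base : IsOpen V
  isOpen : IsOpen U
  isOpen_diff : IsOpen (U \ Z)
  regular : ∀ x ∈ V, IsRegularBase k Z f ρ x
  le_one : ∀ x, ρ x ≤ 1
  unique : ∀ x y y' y'', (x, y') ∈ Z → (x, y'') ∈ Z → dist y y' < ρ x → dist y y'' < ρ x → y' = y''
  continuousOn : ContinuousOn f U
  contDiffOn : ContDiffOn ℝ k f (U \ Z)
  contDiffOn_scale : ContDiffOn ℝ k ε V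
  scale_pos : ∀ x ∈ V, 0 < ε x
  scale_lt : ∀ x ∈ V, ε x < ρ x
  scale_lt_truncDist : ∀ x ∈ V, ε x < truncDist Vᶜ x
  contDiff_bump : ContDiff ℝ k β
  bump_mem : ∀ t, 0 ≤ β t ∧ β t ≤ 1
  bump_eq_one : ∀ t, |t| ≤ 1 / 2 → β t = 1
  bump_eq_zero : ∀ t, 1 ≤ |t| → β t = 0

namespace IsGluing

variable {k : ℕ} {V : Set (α → ℝ)} {ρ ε : (α → ℝ) → ℝ} {β : ℝ → ℝ}
variable (h : IsGluing k V Z U f ρ ε β)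

include h

theorem glue_eq {x : α → ℝ} {y y' : κ → ℝ} (hx : x ∈ V) (hy' : (x, y') ∈ Z)
    (hd : dist y y' < ρ x) : tubeGlue V Z f ρ ε β (x, y) =
      f (x, y) + (∏ j, β ((y j - y' j) / ε x)) * (f (x, y') - f (x, y)) := by
  rw [tubeGlue, if_pos ⟨hx, y', hy', hd⟩, nearPoint_eq h.unique hy' hd]

theorem glue_eq_or (z : (α → ℝ) × (κ → ℝ)) : tubeGlue V Z f ρ ε β z = f z ∨
    z.1 ∈ V ∧ ∃ y', (z.1, y') ∈ Z ∧ dist z.2 y' < ε z.1 ∧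
      |tubeGlue V Z f ρ ε β z - f z| ≤ |f (z.1, y') - f z| := by
  by_cases hc : z.1 ∈ V ∧ ∃ y', (z.1, y') ∈ Z ∧ dist z.2 y' < ρ z.1
  · obtain ⟨hx, y', hy', hd⟩ := hc
    obtain ⟨x, y⟩ := z
    have hε := h.scale_pos x hx
    rw [h.glue_eq hx hy' hd]
    by_cases hj : ∃ j, ε x ≤ |y j - y' j|
    · obtain ⟨j, hj⟩ := hj
      left
      rw [Finset.prod_eq_zero (Finset.mem_univ j), zero_mul, add_zero]
      refine h.bump_eq_zero _ ?_
      rwa [abs_div, abs_of_pos hε, one_le_div hε]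
    · push Not at hj
      refine Or.inr ⟨hx, y', hy', (dist_pi_lt_iff hε).2 hj, ?_⟩
      rw [add_sub_cancel_left, abs_mul, abs_of_nonneg (Finset.prod_nonneg fun j _ =>
        (h.bump_mem _).1)]
      exact mul_le_of_le_one_left (abs_nonneg _) (Finset.prod_le_one (fun j _ =>
        (h.bump_mem _).1) fun j _ => (h.bump_mem _).2)
  · exact Or.inl (by rw [tubeGlue, if_neg hc])

theorem dist_le {x₀ : α → ℝ} {y₀ y' : κ → ℝ} {z : (α → ℝ) × (κ → ℝ)} (hx₀ : x₀ ∉ V)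
    (hz : z.1 ∈ V) (hd : dist z.2 y' < ε z.1) :
    dist (z.1, y') (x₀, y₀) ≤ 2 * dist z (x₀, y₀) := by
  have h1 : ε z.1 < dist z.1 x₀ := (h.scale_lt_truncDist _ hz).trans_le (truncDist_le_dist hx₀)
  have h2 : dist z.1 x₀ ≤ dist z (x₀, y₀) := le_max_left _ _
  have h3 : dist z.2 y₀ ≤ dist z (x₀, y₀) := le_max_right _ _
  have h4 := dist_triangle_left y' y₀ z.2
  have h5 : 0 ≤ dist z.1 x₀ := dist_nonneg
  exact max_le (by linarith) (by linarith)

theorem continuousAt_of_notMem {x₀ : α → ℝ} {y₀ : κ → ℝ} (hx₀ : x₀ ∉ V) (hU : (x₀, y₀) ∈ U) :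
    ContinuousAt (tubeGlue V Z f ρ ε β) (x₀, y₀) := by
  have h0 : tubeGlue V Z f ρ ε β (x₀, y₀) = f (x₀, y₀) := if_neg fun hc => hx₀ hc.1
  rw [Metric.continuousAt_iff, h0]
  intro r hr
  obtain ⟨s, hs, hfs⟩ := Metric.continuousAt_iff.1
    (h.continuousOn.continuousAt (h.isOpen.mem_nhds hU)) (r / 3) (by positivity)
  refine ⟨s / 2, by positivity, fun z hz => ?_⟩
  have h1 := hfs (hz.trans (by linarith))
  rcases h.glue_eq_or z with he | ⟨hzV, y', hy', hd, hle⟩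
  · rw [he]
    linarith
  · have h2 := hfs ((h.dist_le hx₀ hzV hd).trans_lt (by linarith))
    rw [Real.dist_eq] at *
    have h3 : |f (z.1, y') - f z| ≤ |f (z.1, y') - f (x₀, y₀)| + |f z - f (x₀, y₀)| := by
      rw [abs_sub_comm (f z)]
      exact abs_sub_le _ _ _
    have h4 := abs_sub_le (tubeGlue V Z f ρ ε β z) (f z) (f (x₀, y₀))
    linarith

theorem contDiffAt {x₀ : α → ℝ} {y₀ : κ → ℝ} (hU : (x₀, y₀) ∈ U)
    (hz₀ : x₀ ∈ V ∨ (x₀, y₀) ∉ Z) : ContDiffAt ℝ k (tubeGlue V Z f ρ ε β) (x₀, y₀) := by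
  have hf (hZ : (x₀, y₀) ∉ Z) : ContDiffAt ℝ k f (x₀, y₀) :=
    h.contDiffOn.contDiffAt (h.isOpen_diff.mem_nhds ⟨hU, hZ⟩)
  by_cases hx₀ : x₀ ∈ V
  · have hreg := h.regular x₀ hx₀
    have hε : ContDiffAt ℝ k ε x₀ := h.contDiffOn_scale.contDiffAt (h.isOpen_base.mem_nhds hx₀)
    have hfst : ContinuousAt (fun z : (α → ℝ) × (κ → ℝ) => z.1) (x₀, y₀) := continuousAt_fst
    by_cases hlt : truncDist {y' | (x₀, y') ∈ Z} y₀ < ρ x₀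
    · obtain ⟨y₁, hy₁, hd₁⟩ := exists_dist_lt_of_truncDist_lt hlt (h.le_one x₀)
      obtain ⟨γ, hγ, hγ₀, hγZ, hfγ⟩ := hreg.exists_section y₁ hy₁
      have hγc : ContinuousAt (fun z : (α → ℝ) × (κ → ℝ) => γ z.1) (x₀, y₀) :=
        ContinuousAt.comp (f := Prod.fst) hγ.continuousAt hfst
      have hρc : ContinuousAt (fun z : (α → ℝ) × (κ → ℝ) => ρ z.1) (x₀, y₀) :=
        ContinuousAt.comp (f := Prod.fst) hreg.continuousAt hfst
      have hεC : ContDiffAt ℝ k (fun z : (α → ℝ) × (κ → ℝ) => ε z.1) (x₀, y₀) :=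
        ContDiffAt.comp (f := Prod.fst) (x₀, y₀) hε contDiffAt_fst
      have hγC : ContDiffAt ℝ k (fun z : (α → ℝ) × (κ → ℝ) => γ z.1) (x₀, y₀) :=
        ContDiffAt.comp (f := Prod.fst) (x₀, y₀) hγ contDiffAt_fst
      have hfγC : ContDiffAt ℝ k (fun z : (α → ℝ) × (κ → ℝ) => f (z.1, γ z.1)) (x₀, y₀) :=
        ContDiffAt.comp (g := fun x => f (x, γ x)) (f := Prod.fst) (x₀, y₀) hfγ contDiffAt_fst
      have hglue : tubeGlue V Z f ρ ε β =ᶠ[𝓝 (x₀, y₀)] fun z =>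
          f z + (∏ j, β ((z.2 j - γ z.1 j) / ε z.1)) * (f (z.1, γ z.1) - f z) := by
        have hdist : ∀ᶠ z : (α → ℝ) × (κ → ℝ) in 𝓝 (x₀, y₀), dist z.2 (γ z.1) < ρ z.1 :=
          (continuousAt_snd.dist hγc).eventually_lt hρc (by simpa only [hγ₀] using hd₁)
        filter_upwards [hdist, hfst.eventually (h.isOpen_base.mem_nhds hx₀),
          hfst.eventually hγZ] with z hz1 hz2 hz3 using h.glue_eq hz2 hz3 hz1
      refine ContDiffAt.congr_of_eventuallyEq ?_ hglue
      by_cases hZ : (x₀, y₀) ∈ Z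
      · have hy : y₁ = y₀ := h.unique x₀ y₀ y₁ y₀ hy₁ hZ hd₁ (by simpa using hreg.pos)
        refine hfγC.congr_of_eventuallyEq ?_
        have hdist : ∀ᶠ z : (α → ℝ) × (κ → ℝ) in 𝓝 (x₀, y₀),
            dist z.2 (γ z.1) < ε z.1 / 2 := by
          refine (continuousAt_snd.dist hγc).eventually_lt (hεC.continuousAt.div_const 2) ?_
          simpa only [hγ₀, hy, dist_self] using half_pos (h.scale_pos x₀ hx₀)
        filter_upwards [hdist, hfst.eventually (h.isOpen_base.mem_nhds hx₀)] with z hz1 hz2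
        rw [Finset.prod_eq_one fun j _ => h.bump_eq_one _ ?_, one_mul, add_sub_cancel]
        have hε := h.scale_pos _ hz2
        rw [abs_div, abs_of_pos hε, div_le_iff₀ hε, ← Real.dist_eq]
        linarith [dist_le_pi_dist z.2 (γ z.1) j]
      · refine (hf hZ).add (ContDiffAt.mul ?_ (hfγC.sub (hf hZ)))
        refine contDiffAt_prod fun j _ => ?_
        refine h.contDiff_bump.contDiffAt.comp _ (ContDiffAt.div (ContDiffAt.sub ?_ ?_) hεC
          (h.scale_pos x₀ hx₀).ne')
        · exact (by fun_prop : ContDiff ℝ k fun z : (α → ℝ) × (κ → ℝ) => z.2 j).contDiffAt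
        · exact contDiffAt_pi.1 hγC j
    · push Not at hlt
      have hlt := (h.scale_lt x₀ hx₀).trans_le hlt
      have hZ : (x₀, y₀) ∉ Z := fun hZ => by
        have := truncDist_le_dist (A := {y' | (x₀, y') ∈ Z}) (y := y₀) hZ
        rw [dist_self] at this
        linarith [h.scale_pos x₀ hx₀]
      refine (hf hZ).congr_of_eventuallyEq ?_
      have hεc : ContinuousAt (fun z : (α → ℝ) × (κ → ℝ) => ε z.1) (x₀, y₀) :=
        ContinuousAt.comp (f := Prod.fst) hε.continuousAt hfst
      filter_upwards [hεc.eventually_lt (hreg.continuousAt_truncDist y₀) hlt] with z hz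
      rcases h.glue_eq_or z with he | ⟨_, y', hy', hd, _⟩
      · exact he
      · exact absurd (truncDist_le_dist (A := {y' | (z.1, y') ∈ Z}) (y := z.2) hy')
          (hd.trans hz).not_ge
  · have hZ := hz₀.resolve_left hx₀
    refine (hf hZ).congr_of_eventuallyEq ?_
    obtain ⟨r, hr, hball⟩ := Metric.isOpen_iff.1 h.isOpen_diff _ ⟨hU, hZ⟩
    filter_upwards [Metric.ball_mem_nhds _ (half_pos hr)] with z hz
    rcases h.glue_eq_or z with he | ⟨hzV, y', hy', hd, _⟩
    · exact he
    · have hz : dist z (x₀, y₀) < r / 2 := hz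
      exact absurd hy' (hball ((h.dist_le hx₀ hzV hd).trans_lt (by linarith))).2

end IsGluing

theorem DefMap.div_const {E : Type} [PseudoMetricSpace E] [DefSpace E] {f : E → ℝ}
    (hf : DefMap L f) (c : ℝ) : DefMap L fun x => f x / c :=
  inferInstance

/-- If the coordinate projections of `Z` to `ℝ^α × ℝ` are thin, the function `f` can be smoothed
along `Z` outside a subset of `Z` with thin projection to `ℝ^α`. -/
theorem HasApprox.exists_smoothing {k : ℕ} (hα : HasApprox L k α)
    (hZ : DefPred L fun z => z ∈ Z) (hUd : DefPred L fun z => z ∈ U) (hU : IsOpen U) (hZU : Z ⊆ U)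
    (hUZ : IsOpen (U \ Z)) (hfd : DefMap L f) (hf : ContinuousOn f U)
    (hfC : ContDiffOn ℝ k f (U \ Z)) (hδd : DefMap L δ) (hδ : ContinuousOn δ U)
    (hδ0 : ∀ z ∈ U, 0 < δ z)
    (hproj : ∀ j, interior {w : (α → ℝ) × ℝ | ∃ y, (w.1, y) ∈ Z ∧ y j = w.2} = ∅) :
    ∃ (g : (α → ℝ) × (κ → ℝ) → ℝ) (Z' : Set ((α → ℝ) × (κ → ℝ))), DefMap L g ∧
      DefPred L (fun z => z ∈ Z') ∧ Z' ⊆ Z ∧ IsOpen (U \ Z') ∧ ContinuousOn g U ∧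
      ContDiffOn ℝ k g (U \ Z') ∧ (∀ z ∈ U, |g z - f z| < δ z) ∧
      interior {x | ∃ y, (x, y) ∈ Z'} = ∅ := by
  set ρ := tubeRadius Z U f δ with hρ
  have hρd : DefMap L ρ := DefMap.tubeRadius
  have hρm : IsMeagre {x | ¬ 0 < ρ x} := (isMeagre_not_finite_fiber hZ hproj).mono fun x hx hfin =>
    hx (tubeRadius_pos hU hZU hf hδ hδ0 hfin)
  have hρu (x : α → ℝ) (y y' y'' : κ → ℝ) (h' : (x, y') ∈ Z) (h'' : (x, y'') ∈ Z)
      (hd' : dist y y' < ρ x) (hd'' : dist y y'' < ρ x) : y' = y'' :=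
    eq_of_dist_lt_tubeRadius h' h'' hd' hd''
  obtain ⟨V, hV, hVd, hVp, hreg⟩ := exists_isRegularBase k hZ hfd hρd tubeRadius_le_one hρu hρm
  have hTd : DefMap L (truncDist Vᶜ) := by
    have : DefPred L fun z : (α → ℝ) × (α → ℝ) => z.2 ∉ V := inferInstance
    exact DefMap.truncDist (P := fun (_ : α → ℝ) (x : α → ℝ) => x ∉ V) (g := fun x => x)
  have hmind : DefMap L fun x => min (ρ x) (truncDist Vᶜ x) := DefMap.min
  have hmin : ContinuousOn (fun x => min (ρ x) (truncDist Vᶜ x)) V :=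
    ContinuousOn.inf (fun x hx => (hreg x hx).continuousAt.continuousWithinAt)
      (continuous_truncDist _).continuousOn
  have hmin0 (x : α → ℝ) (hx : x ∈ V) : 0 < min (ρ x) (truncDist Vᶜ x) :=
    lt_min (hreg x hx).pos (truncDist_pos (by rwa [compl_compl]) (by simpa using hx))
  obtain ⟨ε, hεd, hεC, hε⟩ := hα V (fun x => min (ρ x) (truncDist Vᶜ x) / 2)
    (fun x => min (ρ x) (truncDist Vᶜ x) / 4) hVp hV (hmind.div_const 2) (hmin.div_const 2)
    (hmind.div_const 4) (hmin.div_const 4) fun x hx => div_pos (hmin0 x hx) (by norm_num)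
  obtain ⟨β, hβd, hβC, hβ, hβ1, hβ0⟩ := exists_bump L k
  have hglue : IsGluing k V Z U f ρ ε β :=
    { isOpen_base := hV
      isOpen := hU
      isOpen_diff := hUZ
      regular := hreg
      le_one := tubeRadius_le_one
      unique := hρu
      continuousOn := hf
      contDiffOn := hfC
      contDiffOn_scale := hεC
      scale_pos := fun x hx => by linarith [(abs_lt.1 (hε x hx)).1, hmin0 x hx]
      scale_lt := fun x hx => by
        linarith [(abs_lt.1 (hε x hx)).2, hmin0 x hx, min_le_left (ρ x) (truncDist Vᶜ x)]
      scale_lt_truncDist := fun x hx => by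
        linarith [(abs_lt.1 (hε x hx)).2, hmin0 x hx, min_le_right (ρ x) (truncDist Vᶜ x)]
      contDiff_bump := hβC
      bump_mem := hβ
      bump_eq_one := hβ1
      bump_eq_zero := hβ0 }
  have hC {z : (α → ℝ) × (κ → ℝ)} (hz : z ∈ U \ {z | z ∈ Z ∧ z.1 ∉ V}) :
      ContDiffAt ℝ k (tubeGlue V Z f ρ ε β) z :=
    hglue.contDiffAt hz.1 (by by_contra hc; push Not at hc; exact hz.2 ⟨hc.2, hc.1⟩)
  refine ⟨tubeGlue V Z f ρ ε β, {z | z ∈ Z ∧ z.1 ∉ V}, DefMap.tubeGlue hVp hZ hfd hρd hεd hβd,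
    ?_, fun z hz => hz.1, ?_, fun z hz => ?_, fun z hz => (hC hz).contDiffWithinAt, fun z hz => ?_,
    ?_⟩
  · simp only [mem_ofPred_eq]
    infer_instance
  · have : U \ {z | z ∈ Z ∧ z.1 ∉ V} = (U \ Z) ∪ (U ∩ Prod.fst ⁻¹' V) := by
      ext z
      simp only [Set.mem_sdiff, mem_ofPred_eq, mem_union, mem_inter_iff, mem_preimage]
      tauto
    rw [this]
    exact hUZ.union (hU.inter (hV.preimage continuous_fst))
  · by_cases hzV : z.1 ∈ V
    · exact (hC ⟨hz, fun hc => hc.2 hzV⟩).continuousAt.continuousWithinAt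
    · exact (hglue.continuousAt_of_notMem hzV hz).continuousWithinAt
  · rcases hglue.glue_eq_or z with he | ⟨hzV, y', hy', hd, hle⟩
    · rw [he, sub_self, abs_zero]
      exact hδ0 z hz
    · exact hle.trans_lt ((isTubeRadius_of_lt (hglue.scale_lt _ hzV)).2 y' z.2 hy'
        (by rwa [dist_comm])).2
  · refine eq_empty_of_forall_notMem fun x hx => ?_
    obtain ⟨x', hx', hx''⟩ := hVd.exists_mem_open isOpen_interior ⟨x, hx⟩
    obtain ⟨y, hy⟩ := interior_subset hx''
    exact hy.2 hx'

end Gluing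

section Induction

variable {L} [hT : TameField L]
variable {ι : Type} [Fintype ι]

/-- The projection of `Z` to the coordinates in `S` has interior. -/
def IsThick (Z : Set (ι → ℝ)) (S : Finset ι) : Prop :=
  ∃ (a : ι → ℝ) (r : ℝ), 0 < r ∧ ∀ v : ι → ℝ, (∀ i ∈ S, |v i - a i| < r) → ∃ x ∈ Z,
    ∀ i ∈ S, x i = v i

omit [Fintype ι] in
theorem IsThick.mono {Z Z' : Set (ι → ℝ)} {S : Finset ι} (h : IsThick Z S) (hZ : Z ⊆ Z') :
    IsThick Z' S := by
  obtain ⟨a, r, hr, h⟩ := h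
  exact ⟨a, r, hr, fun v hv => (h v hv).imp fun x hx => ⟨hZ hx.1, hx.2⟩⟩

omit [Fintype ι] in
theorem isThick_empty {Z : Set (ι → ℝ)} : IsThick Z ∅ ↔ Z.Nonempty :=
  ⟨fun ⟨a, _, _, h⟩ => (h a (by simp)).imp fun _ hx => hx.1,
    fun ⟨x, hx⟩ => ⟨x, 1, one_pos, fun _ _ => ⟨x, hx, by simp⟩⟩⟩

theorem not_isThick_univ {Z : Set (ι → ℝ)} (hZ : interior Z = ∅) :
    ¬ IsThick Z Finset.univ := by
  rintro ⟨a, r, hr, h⟩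
  refine (Set.ext_iff.1 hZ a).1 (mem_interior_iff_mem_nhds.2 ?_)
  filter_upwards [Metric.ball_mem_nhds a hr] with v hv
  obtain ⟨x, hx, hxv⟩ := h v fun i _ => (dist_le_pi_dist v a i).trans_lt hv
  rwa [← funext fun i => hxv i (Finset.mem_univ i)]

theorem HasApprox.exists_smoothing_pi [DecidableEq ι] {k : ℕ} {S : Finset ι}
    (hS : HasApprox L k {i // i ∈ S}) {Z U : Set (ι → ℝ)} {f δ : (ι → ℝ) → ℝ}
    (hZ : DefPred L fun z => z ∈ Z) (hUd : DefPred L fun z => z ∈ U) (hU : IsOpen U) (hZU : Z ⊆ U)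
    (hUZ : IsOpen (U \ Z)) (hfd : DefMap L f) (hf : ContinuousOn f U)
    (hfC : ContDiffOn ℝ k f (U \ Z)) (hδd : DefMap L δ) (hδ : ContinuousOn δ U)
    (hδ0 : ∀ z ∈ U, 0 < δ z) (hthin : ∀ j ∉ S, ¬ IsThick Z (insert j S)) :
    ∃ (g : (ι → ℝ) → ℝ) (Z' : Set (ι → ℝ)), DefMap L g ∧
      DefPred L (fun z => z ∈ Z') ∧ Z' ⊆ Z ∧ IsOpen (U \ Z') ∧ ContinuousOn g U ∧
      ContDiffOn ℝ k g (U \ Z') ∧ (∀ z ∈ U, |g z - f z| < δ z) ∧ ¬ IsThick Z' S := by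
  let e : (ι → ℝ) ≃ₜ ({i // i ∈ S} → ℝ) × ({i // i ∉ S} → ℝ) :=
    Homeomorph.piEquivPiSubtypeProd (fun i => i ∈ S) (fun _ => ℝ)
  have he (z : {i // i ∈ S} → ℝ) (w : {i // i ∉ S} → ℝ) (i : ι) :
      e.symm (z, w) i = if h : i ∈ S then z ⟨i, h⟩ else w ⟨i, h⟩ := rfl
  have heC : ContDiff ℝ k e := by
    have : ContDiff ℝ k fun x : ι → ℝ => ((fun i => x i.1 : {i // i ∈ S} → ℝ),
      (fun i => x i.1 : {i // i ∉ S} → ℝ)) := by fun_prop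
    exact this
  have heC' : ContDiff ℝ k e.symm := by
    refine contDiff_pi.2 fun i => ?_
    change ContDiff ℝ k fun z : ({i // i ∈ S} → ℝ) × ({i // i ∉ S} → ℝ) =>
      if h : i ∈ S then z.1 ⟨i, h⟩ else z.2 ⟨i, h⟩
    split_ifs <;> fun_prop
  have hed : IsReindex e := (isReindex_proj Subtype.val).pair (isReindex_proj Subtype.val)
  have hed' : IsReindex e.symm := by
    refine ⟨fun i => if h : i ∈ S then Sum.inl ⟨i, h⟩ else Sum.inr ⟨i, h⟩, fun z i => ?_⟩
    by_cases h : i ∈ S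
    · simp only [dif_pos h]
      exact (he _ _ i).trans (dif_pos h)
    · simp only [dif_neg h]
      exact (he _ _ i).trans (dif_neg h)
  have hmaps (A : Set (ι → ℝ)) : MapsTo e.symm (e.symm ⁻¹' A) A := fun _ h => h
  obtain ⟨g, Z', hgd, hZ'd, hZ'Z, hUZ', hg, hgC, hgf, hZ'⟩ := hS.exists_smoothing
    (Z := e.symm ⁻¹' Z) (U := e.symm ⁻¹' U) (f := fun z => f (e.symm z))
    (δ := fun z => δ (e.symm z)) (hZ.reindex hed') (hUd.reindex hed')
    (hU.preimage e.symm.continuous) (preimage_mono hZU) (hUZ.preimage e.symm.continuous)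
    (hfd.comp_map hed'.defMap) (hf.comp e.symm.continuous.continuousOn (hmaps U))
    (hfC.comp heC'.contDiffOn (hmaps (U \ Z))) (hδd.comp_map hed'.defMap)
    (hδ.comp e.symm.continuous.continuousOn (hmaps U)) (fun z hz => hδ0 _ hz) (fun j => by
      refine eq_empty_of_forall_notMem fun w hw => hthin j.1 j.2 ?_
      obtain ⟨r, hr, hball⟩ := Metric.mem_nhds_iff.1 (mem_interior_iff_mem_nhds.1 hw)
      refine ⟨e.symm (w.1, fun _ => w.2), r, hr, fun v hv => ?_⟩
      have hd : dist ((fun i => v i.1, v j.1) : ({i // i ∈ S} → ℝ) × ℝ) w < r := by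
        refine max_lt ((dist_pi_lt_iff hr).2 fun i => ?_) ?_
        · have := hv i.1 (Finset.mem_insert_of_mem i.2)
          rwa [he, dif_pos i.2] at this
        · have := hv j.1 (Finset.mem_insert_self _ _)
          rwa [he, dif_neg j.2] at this
      obtain ⟨y, hy, hyj⟩ := hball hd
      refine ⟨_, hy, fun i hi => ?_⟩
      rcases Finset.mem_insert.1 hi with rfl | hi
      · rw [he, dif_neg j.2]
        exact hyj
      · rw [he, dif_pos hi])
  have hpre : e ⁻¹' (e.symm ⁻¹' U \ Z') = U \ e ⁻¹' Z' := by
    ext z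
    simp
  refine ⟨fun x => g (e x), e ⁻¹' Z', hgd.comp_map hed.defMap, hZ'd.reindex hed, fun x hx => ?_,
    ?_, hg.comp e.continuous.continuousOn fun x hx => ?_, ?_, fun x hx => ?_, ?_⟩
  · simpa using hZ'Z hx
  · rw [← hpre]
    exact hUZ'.preimage e.continuous
  · simpa using hx
  · rw [← hpre]
    exact hgC.comp heC.contDiffOn fun _ h => h
  · simpa using hgf (e x) (by simpa using hx)
  · rintro ⟨a, r, hr, h⟩
    refine (Set.ext_iff.1 hZ' (e a).1).1 (mem_interior_iff_mem_nhds.2 ?_)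
    filter_upwards [Metric.ball_mem_nhds (e a).1 hr] with x hx
    obtain ⟨z, hz, hzx⟩ := h (e.symm (x, 0)) fun i hi => by
      rw [he, dif_pos hi]
      exact (dist_le_pi_dist x (e a).1 ⟨i, hi⟩).trans_lt hx
    refine ⟨(e z).2, ?_⟩
    have : x = (e z).1 := funext fun i => by
      have := hzx i.1 i.2
      rw [he, dif_pos i.2] at this
      exact this.symm
    rw [this]
    exact hz

open Classical in
theorem HasApprox.exists_of_card_isThick_le {k : ℕ}
    (hι : ∀ S : Finset ι, S ≠ Finset.univ → HasApprox L k {i // i ∈ S}) {U : Set (ι → ℝ)}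
    (hUd : DefPred L fun z => z ∈ U) (hU : IsOpen U) (m : ℕ) {Z : Set (ι → ℝ)}
    {f δ : (ι → ℝ) → ℝ} (hm : (Finset.univ.filter fun S => IsThick Z S).card ≤ m)
    (hZ : DefPred L fun z => z ∈ Z) (hZU : Z ⊆ U)
    (hUZ : IsOpen (U \ Z)) (hfd : DefMap L f) (hf : ContinuousOn f U)
    (hfC : ContDiffOn ℝ k f (U \ Z)) (hδd : DefMap L δ) (hδ : ContinuousOn δ U)
    (hδ0 : ∀ z ∈ U, 0 < δ z) (hthin : ¬ IsThick Z Finset.univ) :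
    ∃ g : (ι → ℝ) → ℝ, DefMap L g ∧ ContDiffOn ℝ k g U ∧ ∀ x ∈ U, |g x - f x| < δ x := by
  induction m generalizing Z f δ with
  | zero =>
    have hZe : Z = ∅ := not_nonempty_iff_eq_empty.1 fun hne => by
      have : (∅ : Finset ι) ∈ Finset.univ.filter fun S => IsThick Z S := by
        simpa using isThick_empty.2 hne
      simp [Finset.card_eq_zero.1 (Nat.le_zero.1 hm)] at this
    rw [hZe, sdiff_empty] at hfC
    exact ⟨f, hfd, hfC, fun x hx => by simpa using hδ0 x hx⟩
  | succ m ih =>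
    rcases (Finset.univ.filter fun S => IsThick Z S).eq_empty_or_nonempty with he | hne
    · exact ih (by simp [he]) hZ hZU hUZ hfd hf hfC hδd hδ hδ0 hthin
    · obtain ⟨S, hS, hmax⟩ := Finset.exists_max_image _ Finset.card hne
      rw [Finset.mem_filter_univ] at hS
      obtain ⟨g, Z', hgd, hZ'd, hZ'Z, hUZ', hg, hgC, hgf, hZ'⟩ :=
        (hι S fun h => hthin (h ▸ hS)).exists_smoothing_pi hZ hUd hU hZU hUZ hfd hf hfC
        (hδd.div_const 2) (hδ.div_const 2) (fun z hz => half_pos (hδ0 z hz)) (fun j hj ht => by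
          have := hmax _ ((Finset.mem_filter_univ _).2 ht)
          rw [Finset.card_insert_of_notMem hj] at this
          lia)
      have hlt : (Finset.univ.filter fun S => IsThick Z' S).card <
          (Finset.univ.filter fun S => IsThick Z S).card := by
        refine Finset.card_lt_card (Finset.ssubset_iff_of_subset ?_ |>.2 ⟨S, ?_, ?_⟩)
        · exact Finset.monotone_filter_right _ fun S _ h => IsThick.mono h hZ'Z
        · simpa using hS
        · simpa using hZ'
      obtain ⟨g', hg'd, hg'C, hg'g⟩ := ih (by lia) hZ'd (hZ'Z.trans hZU) hUZ' hgd hg hgC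
        (hδd.div_const 2) (hδ.div_const 2) (fun z hz => half_pos (hδ0 z hz))
        (fun ht => hthin (ht.mono hZ'Z))
      refine ⟨g', hg'd, hg'C, fun x hx => ?_⟩
      have := abs_sub_le (g' x) (g x) (f x)
      linarith [hg'g x hx, hgf x hx]

variable (L) in
theorem hasApprox (k : ℕ) (ι : Type) [Fintype ι] : HasApprox L k ι := by
  induction hn : Fintype.card ι using Nat.strong_induction_on generalizing ι with
  | _ n ih =>
    intro U f δ hUd hU hfd hf hδd hδ hδ0
    obtain ⟨O, hO, hOd, hOp, hOC⟩ := hfd.exists_contDiffOn k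
    have hUO : U \ (U \ O) = U ∩ O := by
      rw [sdiff_sdiff_right_self]
    refine HasApprox.exists_of_card_isThick_le (Z := U \ O) (fun S hS => ih _ ?_ _ rfl) hUd hU _
      le_rfl ?_ sdiff_subset ?_ hfd hf ?_ hδd hδ hδ0 (not_isThick_univ ?_)
    · rw [← hn, Fintype.card_coe]
      exact (Finset.card_lt_iff_ne_univ S).2 hS
    · exact DefPred.and (hp := hUd) (hq := DefPred.not (hp := hOp))
    · rw [hUO]
      exact hU.inter hO
    · rw [hUO]
      exact hOC.mono inter_subset_right
    · refine eq_empty_of_forall_notMem fun x hx => ?_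
      obtain ⟨y, hy, hy'⟩ := hOd.exists_mem_open isOpen_interior ⟨x, hx⟩
      exact (interior_subset hy').2 hy

end Induction

section Statement

variable {L}

theorem Def.defPred {n : ℕ} {U : Set (Fin n → ℝ)} (hU : Def L n U) :
    DefPred L fun x : Fin n → ℝ => x ∈ U := ⟨hU⟩

theorem isReindex_append {n m : ℕ} :
    IsReindex fun z : (Fin n → ℝ) × (Fin m → ℝ) => Fin.append z.1 z.2 := by
  refine ⟨Fin.addCases Sum.inl Sum.inr, fun z j => ?_⟩
  refine Fin.addCases (fun i => ?_) (fun i => ?_) j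
  · have h := Fin.addCases_left (motive := fun _ => Fin n ⊕ Fin m) (left := Sum.inl)
      (right := Sum.inr) i
    exact (Fin.append_left z.1 z.2 i).trans (congrArg (DefSpace.chart z) h).symm
  · have h := Fin.addCases_right (motive := fun _ => Fin n ⊕ Fin m) (left := Sum.inl)
      (right := Sum.inr) i
    exact (Fin.append_right z.1 z.2 i).trans (congrArg (DefSpace.chart z) h).symm

theorem isReindex_const : IsReindex fun (x : ℝ) (_ : Fin 1) => x := ⟨fun _ => (), fun _ _ => rfl⟩

open Classical in
theorem DefFunOn.defMap_ite [TameField L] {n : ℕ} {U : Set (Fin n → ℝ)} {f : (Fin n → ℝ) → ℝ}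
    (hU : Def L n U) (hf : DefFunOn L n U f) :
    DefMap L fun x : Fin n → ℝ => if x ∈ U then f x else 0 := by
  have hU' := hU.defPred
  have h : DefPred L fun z : (Fin n → ℝ) × ℝ => z.1 ∈ U ∧ z.2 = f z.1 := by
    have h₀ : DefPred L fun z : Fin (n + 1) → ℝ =>
      fstFun z ∈ U ∧ sndFun z = fun _ => f (fstFun z) := ⟨hf⟩
    have := h₀.reindex (isReindex_append.comp
      (isReindex_fst.pair (isReindex_const.comp isReindex_snd)))
    convert this using 2 with z
    have h₁ : fstFun (Fin.append z.1 fun _ : Fin 1 => z.2) = z.1 :=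
      funext fun i => Fin.append_left _ _ _
    have h₂ : sndFun (Fin.append z.1 fun _ : Fin 1 => z.2) = fun _ => z.2 :=
      funext fun i => Fin.append_right _ _ _
    rw [h₁, h₂, funext_iff]
    simp
  refine DefMap.of_graph (h := ?_) (fun x y => (x ∈ U ∧ y = f x) ∨ (x ∉ U ∧ y = 0))
    fun x y => ?_
  · have h₁ := hU'.reindex (isReindex_fst (F := ℝ))
    infer_instance
  · by_cases hx : x ∈ U <;> simp [hx]

theorem DefMap.defFunOn [TameField L] {n : ℕ} {U : Set (Fin n → ℝ)} {f : (Fin n → ℝ) → ℝ}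
    (hU : Def L n U) (hf : DefMap L f) : DefFunOn L n U f := by
  have hU' := hU.defPred
  have h₁ : IsReindex (fstFun : (Fin (n + 1) → ℝ) → Fin n → ℝ) := isReindex_proj _
  have h₂ : IsReindex fun z : Fin (n + 1) → ℝ => z (Fin.natAdd n 0) := isReindex_apply _
  have h₃ : DefPred L fun z : Fin (n + 1) → ℝ => fstFun z ∈ U := hU'.reindex h₁
  have h₄ : DefMap L fun z : Fin (n + 1) → ℝ => f (fstFun z) := hf.comp_map h₁.defMap
  have h₅ := h₂.defMap (L := L)
  have : DefPred L fun z : Fin (n + 1) → ℝ =>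
      fstFun z ∈ U ∧ z (Fin.natAdd n 0) = f (fstFun z) := inferInstance
  refine (congrArg (Definable univ L) (ext fun z => ?_)).mpr this.out
  simp only [mem_ofPred_eq, funext_iff, Fin.forall_fin_one]
  rfl

end Statement

/-- definable `C^{r+1}` approximation of a definable `C^r` function on a
definable open subset of `ℝⁿ`. -/
theorem statement0
    (hfield : ExpandsOrderedField L) (hlom : LocallyOMinimal L)
    (r n : ℕ) (U : Set (Fin n → ℝ)) (hUdef : Def L n U) (hUopen : IsOpen U)
    (f : (Fin n → ℝ) → ℝ) (hfdef : DefFunOn L n U f) (hfC : ContDiffOn ℝ r f U)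
    (δ : (Fin n → ℝ) → ℝ) (hδdef : DefFunOn L n U δ)
    (hδpos : ∀ x ∈ U, 0 < δ x) (hδcont : ContinuousOn δ U) :
    ∃ ftil : (Fin n → ℝ) → ℝ, DefFunOn L n U ftil ∧ ContDiffOn ℝ (r + 1) ftil U ∧
      ∀ x ∈ U, |f x - ftil x| < δ x := by
  classical
  let _ : TameField L := ⟨hfield, hlom⟩
  have hfe : EqOn (fun x => if x ∈ U then f x else 0) f U := fun x hx => if_pos hx
  have hδe : EqOn (fun x => if x ∈ U then δ x else 0) δ U := fun x hx => if_pos hx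
  obtain ⟨g, hgd, hg, hgf⟩ := hasApprox L (r + 1) (Fin n) U _ _ hUdef.defPred hUopen
    (hfdef.defMap_ite hUdef) (hfC.continuousOn.congr hfe) (hδdef.defMap_ite hUdef)
    (hδcont.congr hδe) fun x hx => (hδpos x hx).trans_eq (hδe hx).symm
  refine ⟨g, hgd.defFunOn hUdef, by exact_mod_cast hg, fun x hx => ?_⟩
  rw [abs_sub_comm]
  simpa [hx] using hgf x hx

end Paper
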